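/- arXiv:2105.12534 — 9 statements merged into one kernel-verified Lean document; each statement's English description precedes it below -/
import Mathlib

section
/- Every dark equivalence relation is self-full: if R is dark and f is a computable reduction of R to itself, then for every y ∈ ℕ there is x ∈ ℕ with R (f x) y. -/
/-- A computable reduction of `R` to `S`: a total computable function `f` with
`R x y ↔ S (f x) (f y)`.  `CompRed R S` means such a reduction exists (`R ≤c S`). -/
def CompRed (R S : ℕ → ℕ → Prop) : Prop :=
  ∃ f : ℕ → ℕ, Computable f ∧ ∀ x y, R x y ↔ S (f x) (f y)

/-- `R ≡c S`. -/
def EquivC (R S : ℕ → ℕ → Prop) : Prop := CompRed R S ∧ CompRed S R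

/-- `R <c S`. -/
def StrictRed (R S : ℕ → ℕ → Prop) : Prop := CompRed R S ∧ ¬ CompRed S R

/-- The identity equivalence relation `Id` on ℕ. -/
def IdEq : ℕ → ℕ → Prop := fun x y => x = y

/-- `Id_n` : congruence modulo `n` on ℕ. -/
def IdN (n : ℕ) : ℕ → ℕ → Prop := fun x y => x % n = y % n

/-- The uniform join `R ⊕ S`. -/
def Join (R S : ℕ → ℕ → Prop) : ℕ → ℕ → Prop := fun a b =>
  (∃ x y, a = 2 * x ∧ b = 2 * y ∧ R x y) ∨
  (∃ x y, a = 2 * x + 1 ∧ b = 2 * y + 1 ∧ S x y)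

/-- The set of equivalence classes of `R`. -/
def classes (R : ℕ → ℕ → Prop) : Set (Set ℕ) := {C | ∃ a, C = {z | R z a}}

/-- `R` is dark: infinitely many classes and `Id` does not reduce to `R`. -/
def Dark (R : ℕ → ℕ → Prop) : Prop := (classes R).Infinite ∧ ¬ CompRed IdEq R

/-- `R` is dark minimal: dark, and everything strictly below has finitely many classes. -/
def DarkMinimal (R : ℕ → ℕ → Prop) : Prop :=
  Dark R ∧ ∀ S : ℕ → ℕ → Prop, Equivalence S → StrictRed S R → (classes S).Finite

/-- `T` is a least upper bound of `R` and `S` in the computable-reducibility order. -/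
def IsLub' (R S T : ℕ → ℕ → Prop) : Prop :=
  CompRed R T ∧ CompRed S T ∧
    ∀ U : ℕ → ℕ → Prop, Equivalence U → CompRed R U → CompRed S U → CompRed T U

/-- `W` is computably enumerable. -/
def CE (W : Set ℕ) : Prop := W = ∅ ∨ ∃ f : ℕ → ℕ, Computable f ∧ W = Set.range f

/-- `R ≤_F S`: `R` restricted to a decidable set `A` computably reduces to `S`,
and `R` restricted to the complement of `A` has finitely many classes. -/
def FRed (R S : ℕ → ℕ → Prop) : Prop :=
  ∃ A : Set ℕ, ComputablePred (· ∈ A) ∧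
    (∃ f : ℕ → ℕ, Computable f ∧ ∀ x ∈ A, ∀ y ∈ A, (R x y ↔ S (f x) (f y))) ∧
    {C : Set ℕ | ∃ a ∉ A, C = {z | z ∉ A ∧ R z a}}.Finite

/-- `U` is a pure quotient of `R ⊕ S`. -/
def PureQuotient (R S U : ℕ → ℕ → Prop) : Prop :=
  (∀ a b, Join R S a b → U a b) ∧
  (∀ x y, U (2 * x) (2 * y) ↔ R x y) ∧
  (∀ x y, U (2 * x + 1) (2 * y + 1) ↔ S x y)

/-- `R` is noncomputably avoiding: for every finite set of representatives of
noncomputable `R`-classes, some self-reduction of `R` avoids all those classes. -/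
def NCA (R : ℕ → ℕ → Prop) : Prop :=
  ∀ F : Finset ℕ, (∀ a ∈ F, ¬ ComputablePred fun z => R z a) →
    ∃ g : ℕ → ℕ, Computable g ∧ (∀ x y, R x y ↔ R (g x) (g y)) ∧
      ∀ a ∈ F, ∀ x, ¬ R (g x) a

/-- `R` is self-full: every computable self-reduction of `R` hits every `R`-class. -/
def SelfFull (R : ℕ → ℕ → Prop) : Prop :=
  ∀ f : ℕ → ℕ, Computable f → (∀ x y, R x y ↔ R (f x) (f y)) → ∀ y, ∃ x, R (f x) y

/-- `T` is a strong minimal cover of `R`. -/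
def StrongMinCover (R T : ℕ → ℕ → Prop) : Prop :=
  StrictRed R T ∧ ∀ X : ℕ → ℕ → Prop, Equivalence X → StrictRed X T → CompRed X R

theorem not_rel_iterate_of_avoids {R : ℕ → ℕ → Prop} {f : ℕ → ℕ}
    (hred : ∀ x y, R x y ↔ R (f x) (f y)) {y : ℕ} (hy : ∀ x, ¬ R (f x) y) (d n : ℕ) :
    ¬ R (f^[n + (d + 1)] y) (f^[n] y) := by
  induction n with
  | zero =>
    rw [Nat.zero_add, Function.iterate_succ_apply']
    exact hy _
  | succ n ih =>
    rw [Nat.add_right_comm, Function.iterate_succ_apply', Function.iterate_succ_apply', ← hred]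
    exact ih

theorem computable_iterate_apply {f : ℕ → ℕ} (hf : Computable f) (y : ℕ) :
    Computable fun n => f^[n] y := by
  refine (Computable.nat_rec (f := id) (g := fun _ => y) (h := fun _ p => f p.2)
    Computable.id (Computable.const y)
    (hf.comp (Computable.snd.comp Computable.snd)).to₂).of_eq fun n => ?_
  induction n with
  | zero => rfl
  | succ n ih =>
    rw [Function.iterate_succ_apply', ← ih]
    rfl

theorem stmt_2 (R : ℕ → ℕ → Prop) (hR : Equivalence R) (hdark : Dark R)
    (f : ℕ → ℕ) (hf : Computable f) (hred : ∀ x y, R x y ↔ R (f x) (f y)) :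
    ∀ y, ∃ x, R (f x) y := by
  intro y
  by_contra! hy
  refine hdark.2 ⟨fun n => f^[n] y, computable_iterate_apply hf y, fun m n => ⟨?_, fun h => ?_⟩⟩
  · rintro rfl
    exact hR.refl _
  · rcases lt_trichotomy m n with hlt | heq | hlt
    · obtain ⟨d, rfl⟩ := Nat.exists_eq_add_of_lt hlt
      exact (not_rel_iterate_of_avoids hred hy d m (hR.symm h)).elim
    · exact heq
    · obtain ⟨d, rfl⟩ := Nat.exists_eq_add_of_lt hlt
      exact (not_rel_iterate_of_avoids hred hy d n h).elim
end

section
/- If R is a dark equivalence relation and R' is an equivalence relation on ℕ with R ⊆ R' and R ≠ R' (i.e., R' is a proper quotient of R), then ¬(R ≤c R'). -/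
/-- Iterates of a computable function at stages `0, M, 2M, …` form a computable sequence. -/
theorem computable_iterate_mul {f : ℕ → ℕ} (hf : Computable f) (M a : ℕ) :
    Computable fun i => f^[M * i] a := by
  have h : Computable fun n : ℕ => f^[n] a := by
    have h' : Computable fun n : ℕ =>
        (Nat.rec a (fun _ y => f y) n : ℕ) :=
      Computable.nat_rec Computable.id (Computable.const a)
        (hf.comp (Computable.snd.comp Computable.snd)).to₂
    refine h'.of_eq fun n => ?_
    induction n with
    | zero => rfl
    | succ n ih => rw [Function.iterate_succ_apply', ← ih]
  exact h.comp (Primrec.nat_mul.to_comp.comp (Computable.const M) Computable.id)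

/-- If `f` reflects `R`, then so does every iterate of `f`. -/
theorem reflects_iterate {R : ℕ → ℕ → Prop} {f : ℕ → ℕ}
    (hrefl : ∀ x y, R (f x) (f y) → R x y) (n : ℕ) {x y : ℕ}
    (h : R (f^[n] x) (f^[n] y)) : R x y := by
  induction n with
  | zero => exact h
  | succ n ih =>
    simp only [Function.iterate_succ_apply'] at h
    exact ih (hrefl _ _ h)

/-- If `Id` does not reduce to `R` and the computable function `f` reflects `R`, then every
point returns to its class under some positive iterate of `f^[M]`. -/
theorem exists_return {R : ℕ → ℕ → Prop} (hR : Equivalence R) (hId : ¬ CompRed IdEq R)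
    {f : ℕ → ℕ} (hf : Computable f) (hrefl : ∀ x y, R (f x) (f y) → R x y) (a M : ℕ) :
    ∃ j, 0 < j ∧ R a (f^[M * j] a) := by
  by_contra! hno
  have hlt : ∀ i j, i < j → ¬ R (f^[M * i] a) (f^[M * j] a) := by
    intro i j hij h
    obtain ⟨d, rfl⟩ := Nat.exists_eq_add_of_lt hij
    rw [add_assoc, mul_add, Function.iterate_add_apply] at h
    exact hno (d + 1) d.succ_pos (reflects_iterate hrefl _ h)
  refine hId ⟨_, computable_iterate_mul hf M a, fun i j => ⟨?_, fun h => ?_⟩⟩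
  · rintro rfl
    exact hR.refl _
  · rcases lt_trichotomy i j with hij | hij | hij
    · exact absurd h (hlt i j hij)
    · exact hij
    · exact absurd (hR.symm h) (hlt j i hij)

/-- A return time can be subtracted from any later return time. -/
theorem return_of_add {R : ℕ → ℕ → Prop} (hR : Equivalence R) {f : ℕ → ℕ}
    (hrefl : ∀ x y, R (f x) (f y) → R x y) {a k m : ℕ}
    (hk : R a (f^[k] a)) (h : R a (f^[k + m] a)) : R a (f^[m] a) := by
  rw [Function.iterate_add_apply] at h
  exact reflects_iterate hrefl k (hR.trans (hR.symm hk) h)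

/-- Multiples of a return time are return times. -/
theorem return_mul {R : ℕ → ℕ → Prop} (hR : Equivalence R) (hId : ¬ CompRed IdEq R)
    {f : ℕ → ℕ} (hf : Computable f) (hrefl : ∀ x y, R (f x) (f y) → R x y) {a k : ℕ}
    (hk : R a (f^[k] a)) (M : ℕ) : R a (f^[k * M] a) := by
  have hsubtract : ∀ t m, R a (f^[k * t + m] a) → R a (f^[m] a) := by
    intro t
    induction t with
    | zero => intro m h; simpa using h
    | succ t ih =>
      intro m h
      refine ih m (return_of_add hR hrefl hk ?_)
      rwa [← add_assoc, add_comm k, ← Nat.mul_succ]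
  obtain ⟨j, hj, h⟩ := exists_return hR hId hf hrefl a (k * M)
  obtain ⟨i, rfl⟩ := Nat.exists_eq_succ_of_ne_zero hj.ne'
  refine hsubtract (M * i) _ ?_
  rwa [← mul_assoc, ← Nat.mul_succ]

theorem stmt_3 (R R' : ℕ → ℕ → Prop) (hR : Equivalence R) (hR' : Equivalence R')
    (hdark : Dark R) (hsub : ∀ x y, R x y → R' x y) (hne : R ≠ R') :
    ¬ CompRed R R' := by
  rintro ⟨f, hf, hred⟩
  have hrefl : ∀ x y, R (f x) (f y) → R x y := fun x y h => (hred x y).2 (hsub _ _ h)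
  refine hne (funext₂ fun a b => propext ⟨hsub a b, fun hab => ?_⟩)
  obtain ⟨k, hk, hak⟩ := exists_return hR hdark.2 hf hrefl a 1
  obtain ⟨l, hl, hbl⟩ := exists_return hR hdark.2 hf hrefl b 1
  rw [one_mul] at hak hbl
  have ha := hsub _ _ (return_mul hR hdark.2 hf hrefl hak l)
  have hb := hsub _ _ (return_mul hR hdark.2 hf hrefl hbl k)
  rw [mul_comm] at hb
  have h := hR'.trans (hR'.symm ha) (hR'.trans hab hb)
  obtain ⟨n, hn⟩ := Nat.exists_eq_succ_of_ne_zero (Nat.mul_pos hk hl).ne'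
  simp only [hn, Nat.succ_eq_add_one, Function.iterate_succ_apply'] at h
  exact reflects_iterate hrefl n ((hred _ _).2 h)
end

section
/- Let R be a dark minimal equivalence relation and let W ⊆ ℕ be a computably enumerable set. If W intersects infinitely many R-equivalence classes, then W intersects every R-equivalence class. -/
theorem computable_iterate {g : ℕ → ℕ} (hg : Computable g) (a : ℕ) :
    Computable fun n => g^[n] a := by
  refine (Computable.nat_rec (f := fun n : ℕ => n) (g := fun _ => a)
    (h := fun _ p => g p.2) Computable.id (Computable.const a)
    (hg.comp (Computable.snd.comp Computable.snd)).to₂).of_eq fun n => ?_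
  induction n with
  | zero => rfl
  | succ n ih => rw [Function.iterate_succ_apply', ← ih]

/-- Iterating a self-reduction that misses the class of `a` produces pairwise inequivalent
numbers, so a dark relation is self-full. -/
theorem Dark.selfFull {R : ℕ → ℕ → Prop} (hR : Equivalence R) (hd : Dark R) : SelfFull R := by
  intro g hg hgR a
  by_contra! ha
  have hiter : ∀ i x y, R x y ↔ R (g^[i] x) (g^[i] y) := by
    intro i
    induction i with
    | zero => exact fun _ _ => Iff.rfl
    | succ i ih =>
      intro x y
      rw [Function.iterate_succ_apply, Function.iterate_succ_apply, ← ih, ← hgR]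
  have hne : ∀ i k, ¬ R (g^[i + (k + 1)] a) (g^[i] a) := by
    intro i k h
    rw [Function.iterate_add_apply, ← hiter, Function.iterate_succ_apply'] at h
    exact ha _ h
  refine hd.2 ⟨fun n => g^[n] a, computable_iterate hg a, fun i j => ⟨?_, fun h => ?_⟩⟩
  · rintro rfl
    exact hR.refl _
  · rcases lt_trichotomy i j with hij | hij | hij
    · obtain ⟨k, rfl⟩ := Nat.exists_eq_add_of_lt hij
      exact (hne i k (hR.symm h)).elim
    · exact hij
    · obtain ⟨k, rfl⟩ := Nat.exists_eq_add_of_lt hij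
      exact (hne j k h).elim

/-- The pullback of `R` along `f` has as many classes as there are `R`-classes meeting the
range of `f`. -/
theorem classes_pullback_infinite {R : ℕ → ℕ → Prop} (hR : Equivalence R) (f : ℕ → ℕ)
    (hinf : {C ∈ classes R | (C ∩ Set.range f).Nonempty}.Infinite) :
    (classes fun x y => R (f x) (f y)).Infinite := by
  intro hfin
  refine hinf ((hfin.image fun D => {z | ∃ x ∈ D, R z (f x)}).subset ?_)
  rintro C ⟨⟨a, rfl⟩, _, hxa, x, rfl⟩
  refine ⟨{z | R (f z) (f x)}, ⟨x, rfl⟩, ?_⟩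
  ext z
  constructor
  · rintro ⟨y, hy, hz⟩
    exact hR.trans hz (hR.trans hy hxa)
  · intro hz
    exact ⟨x, hR.refl _, hR.trans hz (hR.symm hxa)⟩

theorem stmt_4 (R : ℕ → ℕ → Prop) (hR : Equivalence R) (hmin : DarkMinimal R)
    (W : Set ℕ) (hW : CE W)
    (hinf : {C ∈ classes R | (C ∩ W).Nonempty}.Infinite) :
    ∀ C ∈ classes R, (C ∩ W).Nonempty := by
  obtain rfl | ⟨f, hf, rfl⟩ := hW
  · simp at hinf
  have hS : Equivalence fun x y => R (f x) (f y) :=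
    ⟨fun _ => hR.refl _, fun h => hR.symm h, fun h h' => hR.trans h h'⟩
  have hred : CompRed R fun x y => R (f x) (f y) := by
    by_contra hn
    exact classes_pullback_infinite hR f hinf (hmin.2 _ hS ⟨⟨f, hf, fun _ _ => Iff.rfl⟩, hn⟩)
  obtain ⟨g, hg, hgR⟩ := hred
  rintro _ ⟨a, rfl⟩
  obtain ⟨x, hx⟩ := hmin.1.selfFull hR (f ∘ g) (hf.comp hg) hgR a
  exact ⟨f (g x), hx, g x, rfl⟩
end

section
/- If R and S are equivalence relations on ℕ which are ≤_F-incomparable, then R and S do not have a least upper bound: no equivalence relation T on ℕ is a least upper bound of R and S. -/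
/-- A set of pairs is a matching of `R`-classes with `S`-classes. -/
def IsClassMatching (R S : ℕ → ℕ → Prop) (M : Set (ℕ × ℕ)) : Prop :=
  ∀ p ∈ M, ∀ q ∈ M, R p.1 q.1 ↔ S p.2 q.2

/-- The quotient of `R ⊕ S` identifying the classes of `2 * a` and `2 * b + 1`
for every `(a, b) ∈ M`. -/
def Glue (R S : ℕ → ℕ → Prop) (M : Set (ℕ × ℕ)) (u v : ℕ) : Prop :=
  match u.bodd, v.bodd with
  | false, false => R u.div2 v.div2
  | true, true => S u.div2 v.div2
  | false, true => ∃ p ∈ M, R p.1 u.div2 ∧ S p.2 v.div2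
  | true, false => ∃ p ∈ M, S p.2 u.div2 ∧ R p.1 v.div2

section Glue

variable {R S : ℕ → ℕ → Prop} {M : Set (ℕ × ℕ)} {u v : ℕ}

lemma glue_even_even (hu : u.bodd = false) (hv : v.bodd = false) :
    Glue R S M u v ↔ R u.div2 v.div2 := by simp [Glue, hu, hv]

lemma glue_odd_odd (hu : u.bodd = true) (hv : v.bodd = true) :
    Glue R S M u v ↔ S u.div2 v.div2 := by simp [Glue, hu, hv]

lemma glue_even_odd (hu : u.bodd = false) (hv : v.bodd = true) :
    Glue R S M u v ↔ ∃ p ∈ M, R p.1 u.div2 ∧ S p.2 v.div2 := by simp [Glue, hu, hv]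

lemma glue_odd_even (hu : u.bodd = true) (hv : v.bodd = false) :
    Glue R S M u v ↔ ∃ p ∈ M, S p.2 u.div2 ∧ R p.1 v.div2 := by simp [Glue, hu, hv]

lemma Glue.equivalence (hR : Equivalence R) (hS : Equivalence S)
    (hM : IsClassMatching R S M) : Equivalence (Glue R S M) where
  refl u := by
    cases hu : u.bodd
    · exact (glue_even_even hu hu).2 (hR.refl _)
    · exact (glue_odd_odd hu hu).2 (hS.refl _)
  symm {u v} h := by
    cases hu : u.bodd <;> cases hv : v.bodd <;> simp only [Glue, hu, hv] at h ⊢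
    · exact hR.symm h
    · obtain ⟨p, hp, h₁, h₂⟩ := h
      exact ⟨p, hp, h₂, h₁⟩
    · obtain ⟨p, hp, h₁, h₂⟩ := h
      exact ⟨p, hp, h₂, h₁⟩
    · exact hS.symm h
  trans {u v w} h k := by
    cases hu : u.bodd <;> cases hv : v.bodd <;> cases hw : w.bodd <;>
      simp only [Glue, hu, hv, hw] at h k ⊢
    · exact hR.trans h k
    · obtain ⟨p, hp, h₁, h₂⟩ := k
      exact ⟨p, hp, hR.trans h₁ (hR.symm h), h₂⟩
    · obtain ⟨p, hp, h₁, h₂⟩ := h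
      obtain ⟨q, hq, k₁, k₂⟩ := k
      have := (hM p hp q hq).2 (hS.trans h₂ (hS.symm k₁))
      exact hR.trans (hR.symm h₁) (hR.trans this k₂)
    · obtain ⟨p, hp, h₁, h₂⟩ := h
      exact ⟨p, hp, h₁, hS.trans h₂ k⟩
    · obtain ⟨p, hp, h₁, h₂⟩ := h
      exact ⟨p, hp, h₁, hR.trans h₂ k⟩
    · obtain ⟨p, hp, h₁, h₂⟩ := h
      obtain ⟨q, hq, k₁, k₂⟩ := k
      have := (hM p hp q hq).1 (hR.trans h₂ (hR.symm k₁))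
      exact hS.trans (hS.symm h₁) (hS.trans this k₂)
    · obtain ⟨p, hp, h₁, h₂⟩ := k
      exact ⟨p, hp, hS.trans h₁ (hS.symm h), h₂⟩
    · exact hS.trans h k

variable (R S M)

lemma compRed_glue_left : CompRed R (Glue R S M) :=
  ⟨fun x => 2 * x, Primrec.nat_double.to_comp, fun x y => by
    rw [glue_even_even (by simp) (by simp)]; simp [Nat.div2_val]⟩

lemma compRed_glue_right : CompRed S (Glue R S M) :=
  ⟨fun x => 2 * x + 1, Primrec.nat_double_succ.to_comp, fun x y => by
    rw [glue_odd_odd (by simp) (by simp)]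
    simp [Nat.div2_val]⟩

end Glue

/-- A criterion for `FRed`: the complement of the domain is covered by finitely many sets,
each inside a single class. -/
lemma fRed_of_cover {Q P : ℕ → ℕ → Prop} (hQ : Equivalence Q) {A : Set ℕ}
    (hA : ComputablePred (· ∈ A)) {f : ℕ → ℕ} (hf : Computable f)
    (hred : ∀ x ∈ A, ∀ y ∈ A, (Q x y ↔ P (f x) (f y)))
    {ι : Type*} {s : Set ι} (hs : s.Finite) (D : ι → Set ℕ)
    (hcover : ∀ a ∉ A, ∃ i ∈ s, a ∈ D i)
    (hD : ∀ i ∈ s, ∀ z ∉ A, ∀ w ∉ A, z ∈ D i → w ∈ D i → Q z w) : FRed Q P := by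
  refine ⟨A, hA, ⟨f, hf, hred⟩,
    (hs.image fun i => {z | z ∉ A ∧ ∃ w ∉ A, w ∈ D i ∧ Q z w}).subset ?_⟩
  rintro C ⟨a, ha, rfl⟩
  obtain ⟨i, hi, hai⟩ := hcover a ha
  refine ⟨i, hi, Set.ext fun z => and_congr_right fun _ => ⟨?_, fun h => ⟨a, ha, hai, h⟩⟩⟩
  rintro ⟨w, hw, hwi, hzw⟩
  exact hQ.trans hzw (hD i hi w hw a ha hwi hai)

lemma computablePred_bodd_eq {f : ℕ → ℕ} (hf : Computable f) (b : Bool) :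
    ComputablePred (· ∈ {z | (f z).bodd = b}) := by
  refine ComputablePred.computable_iff.2
    ⟨fun z => (f z).bodd == b, ?_, funext fun z => by simp⟩
  exact Primrec.beq.to_comp.comp (Primrec.nat_bodd.to_comp.comp hf) (Computable.const b)

section Diagonalization

variable {R S T : ℕ → ℕ → Prop} {M N : Set (ℕ × ℕ)} {φ : ℕ → ℕ}

/-- If all but finitely many classes of `T` are sent by a reduction `T ≤c Glue R S N`
to odd numbers, then every `R ≤c T` satisfies `R ≤_F S`. -/
lemma fRed_of_even_almost_matched (hR : Equivalence R) (hT : Equivalence T)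
    (hRT : CompRed R T) (hM : M.Finite) (hφ : Computable φ)
    (hred : ∀ x y, T x y ↔ Glue R S N (φ x) (φ y)) (y₀ : ℕ)
    (h : ∀ x, (φ x).bodd = false → (∀ p ∈ M, ¬ R p.1 (φ x).div2) → T x y₀) :
    FRed R S := by
  obtain ⟨f, hf, hfT⟩ := hRT
  have hψ : Computable fun z => φ (f z) := hφ.comp hf
  refine fRed_of_cover hR (computablePred_bodd_eq hψ true)
    (Primrec.nat_div2.to_comp.comp hψ)
    (fun x hx y hy => by rw [hfT, hred, glue_odd_odd hx hy])
    ((hM.image some).insert none)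
    (fun i => i.elim {z | T (f z) y₀} fun p => {z | R p.1 (φ (f z)).div2}) ?_ ?_
  · intro a ha
    by_cases hp : ∃ p ∈ M, R p.1 (φ (f a)).div2
    · obtain ⟨p, hp, hpa⟩ := hp
      exact ⟨some p, by simpa using hp, hpa⟩
    · push Not at hp
      exact ⟨none, by simp, h _ (by simpa using ha) hp⟩
  · rintro (_ | p) - z hz w hw hzi hwi
    · exact (hfT z w).2 (hT.trans hzi (hT.symm hwi))
    · rw [hfT, hred, glue_even_even (by simpa using hz) (by simpa using hw)]
      exact hR.trans (hR.symm hzi) hwi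

/-- If all but finitely many classes of `T` are sent by a reduction `T ≤c Glue R S N`
to even numbers, then every `S ≤c T` satisfies `S ≤_F R`. -/
lemma fRed_of_odd_almost_matched (hS : Equivalence S) (hT : Equivalence T)
    (hST : CompRed S T) (hM : M.Finite) (hφ : Computable φ)
    (hred : ∀ x y, T x y ↔ Glue R S N (φ x) (φ y)) (y₀ : ℕ)
    (h : ∀ x, (φ x).bodd = true → (∀ p ∈ M, ¬ S p.2 (φ x).div2) → T x y₀) :
    FRed S R := by
  obtain ⟨f, hf, hfT⟩ := hST
  have hψ : Computable fun z => φ (f z) := hφ.comp hf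
  refine fRed_of_cover hS (computablePred_bodd_eq hψ false)
    (Primrec.nat_div2.to_comp.comp hψ)
    (fun x hx y hy => by rw [hfT, hred, glue_even_even hx hy])
    ((hM.image some).insert none)
    (fun i => i.elim {z | T (f z) y₀} fun p => {z | S p.2 (φ (f z)).div2}) ?_ ?_
  · intro a ha
    by_cases hp : ∃ p ∈ M, S p.2 (φ (f a)).div2
    · obtain ⟨p, hp, hpa⟩ := hp
      exact ⟨some p, by simpa using hp, hpa⟩
    · push Not at hp
      exact ⟨none, by simp, h _ (by simpa using ha) hp⟩
  · rintro (_ | p) - z hz w hw hzi hwi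
    · exact (hfT z w).2 (hT.trans hzi (hT.symm hwi))
    · rw [hfT, hred, glue_odd_odd (by simpa using hz) (by simpa using hw)]
      exact hS.trans (hS.symm hzi) hwi

lemma exists_unmatched_pair (hR : Equivalence R) (hS : Equivalence S) (hT : Equivalence T)
    (hRT : CompRed R T) (hST : CompRed S T) (h1 : ¬ FRed R S) (h2 : ¬ FRed S R)
    (hM : M.Finite) (hφ : Computable φ)
    (hred : ∀ x y, T x y ↔ Glue R S N (φ x) (φ y)) :
    ∃ x y, ¬ T x y ∧ (φ x).bodd = false ∧ (φ y).bodd = true ∧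
      (∀ p ∈ M, ¬ R p.1 (φ x).div2) ∧ (∀ p ∈ M, ¬ S p.2 (φ y).div2) := by
  by_contra! hno
  by_cases hy : ∃ y, (φ y).bodd = true ∧ ∀ p ∈ M, ¬ S p.2 (φ y).div2
  · obtain ⟨y, hy, hyM⟩ := hy
    refine h1 (fRed_of_even_almost_matched hR hT hRT hM hφ hred y fun x hx hxM => ?_)
    by_contra hxy
    obtain ⟨p, hp, hpy⟩ := hno x y hxy hx hy hxM
    exact hyM p hp hpy
  · exact h2 (fRed_of_odd_almost_matched hS hT hST hM hφ hred 0
      fun x hx hxM => (hy ⟨x, hx, hxM⟩).elim)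

lemma IsClassMatching.insert (hR : Equivalence R) (hS : Equivalence S)
    (hM : IsClassMatching R S M) {a b : ℕ} (ha : ∀ p ∈ M, ¬ R p.1 a)
    (hb : ∀ p ∈ M, ¬ S p.2 b) : IsClassMatching R S (insert (a, b) M) := by
  rintro p (rfl | hp) q (rfl | hq)
  · exact iff_of_true (hR.refl _) (hS.refl _)
  · exact iff_of_false (fun h => ha q hq (hR.symm h)) (fun h => hb q hq (hS.symm h))
  · exact iff_of_false (ha p hp) (hb p hp)
  · exact hM p hp q hq

/-- Every finite matching extends to a finite matching which forces a given computable function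
not to be a reduction of `T`. -/
lemma exists_matching_not_reduction (hR : Equivalence R) (hS : Equivalence S)
    (hT : Equivalence T) (hRT : CompRed R T) (hST : CompRed S T)
    (h1 : ¬ FRed R S) (h2 : ¬ FRed S R) (hM : M.Finite) (hMm : IsClassMatching R S M)
    (hφ : Computable φ) :
    ∃ M' : Set (ℕ × ℕ), M'.Finite ∧ IsClassMatching R S M' ∧ M ⊆ M' ∧
      ∀ N, M' ⊆ N → ¬ ∀ x y, T x y ↔ Glue R S N (φ x) (φ y) := by
  by_cases h : ∃ N, ∀ x y, T x y ↔ Glue R S N (φ x) (φ y)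
  · obtain ⟨N, hred⟩ := h
    obtain ⟨x, y, hxy, hx, hy, hxM, hyM⟩ :=
      exists_unmatched_pair hR hS hT hRT hST h1 h2 hM hφ hred
    refine ⟨insert ((φ x).div2, (φ y).div2) M, hM.insert _, hMm.insert hR hS hxM hyM,
      Set.subset_insert _ _, fun N' hN' hred' => hxy ?_⟩
    rw [hred', glue_even_odd hx hy]
    exact ⟨_, hN' (Set.mem_insert _ _), hR.refl _, hS.refl _⟩
  · push Not at h
    exact ⟨M, hM, hMm, subset_rfl, fun N _ hN => by
      obtain ⟨x, y, hxy⟩ := h N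
      have := hN x y
      tauto⟩

end Diagonalization

lemma countable_computable : Countable {f : ℕ → ℕ // Computable f} := by
  have hcode (f : {f : ℕ → ℕ // Computable f}) :
      ∃ c : Nat.Partrec.Code, c.eval = fun n => Part.some (f.1 n) :=
    Nat.Partrec.Code.exists_code.1 (Partrec.nat_iff.1 f.2)
  choose c hc using hcode
  refine Function.Injective.countable (f := c) fun f g hfg => Subtype.ext (funext fun n => ?_)
  have := congrFun ((hc f).symm.trans ((congrArg _ hfg).trans (hc g))) n
  exact Part.some_injective this

/-- Finite matchings of `R`-classes with `S`-classes, ordered by inclusion. -/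
abbrev FiniteMatching (R S : ℕ → ℕ → Prop) : Type :=
  {M : Set (ℕ × ℕ) // M.Finite ∧ IsClassMatching R S M}

theorem stmt_7 (R S : ℕ → ℕ → Prop) (hR : Equivalence R) (hS : Equivalence S)
    (h1 : ¬ FRed R S) (h2 : ¬ FRed S R) :
    ∀ T : ℕ → ℕ → Prop, Equivalence T → ¬ IsLub' R S T := by
  rintro T hT ⟨hRT, hST, hlub⟩
  have := countable_computable
  let _ : Encodable {f : ℕ → ℕ // Computable f} := Encodable.ofCountable _
  let 𝒟 (φ : {f : ℕ → ℕ // Computable f}) : Order.Cofinal (FiniteMatching R S) :=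
    { carrier := {M | ∀ N, M.1 ⊆ N → ¬ ∀ x y, T x y ↔ Glue R S N (φ.1 x) (φ.1 y)}
      isCofinal := fun M => by
        obtain ⟨M', hfin, hm, hsub, hforce⟩ :=
          exists_matching_not_reduction hR hS hT hRT hST h1 h2 M.2.1 M.2.2 φ.2
        exact ⟨⟨M', hfin, hm⟩, hforce, hsub⟩ }
  let I := Order.idealOfCofinals
    (⟨∅, Set.finite_empty, fun _ h => h.elim⟩ : FiniteMatching R S) 𝒟
  let N : Set (ℕ × ℕ) := ⋃ M ∈ I, M.1
  have hN : IsClassMatching R S N := by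
    intro p hp q hq
    simp only [N, Set.mem_iUnion] at hp hq
    obtain ⟨M, hM, hpM⟩ := hp
    obtain ⟨M', hM', hqM'⟩ := hq
    obtain ⟨L, -, hL, hL'⟩ := I.directed M hM M' hM'
    exact L.2.2 p (hL hpM) q (hL' hqM')
  obtain ⟨φ, hφ, hred⟩ := hlub (Glue R S N) (Glue.equivalence hR hS hN)
    (compRed_glue_left R S N) (compRed_glue_right R S N)
  obtain ⟨M, hMD, hMI⟩ := Order.cofinal_meets_idealOfCofinals
    (⟨∅, Set.finite_empty, fun _ h => h.elim⟩ : FiniteMatching R S) 𝒟 ⟨φ, hφ⟩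
  exact hMD N (Set.subset_biUnion_of_mem (u := fun M : FiniteMatching R S => M.1) hMI) hred
end

section
/- No dark equivalence relation has a least upper bound with Id: if R is dark, then no equivalence relation T on ℕ is a least upper bound of R and Id. -/
theorem join_even (R S : ℕ → ℕ → Prop) (x y : ℕ) : Join R S (2 * x) (2 * y) ↔ R x y := by
  constructor
  · rintro (⟨a, b, ha, hb, h⟩ | ⟨a, b, ha, hb, h⟩)
    · obtain rfl : x = a := by omega
      obtain rfl : y = b := by omega
      exact h
    · omega
  · exact fun h => Or.inl ⟨x, y, rfl, rfl, h⟩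

theorem join_odd (R S : ℕ → ℕ → Prop) (x y : ℕ) :
    Join R S (2 * x + 1) (2 * y + 1) ↔ S x y := by
  constructor
  · rintro (⟨a, b, ha, hb, h⟩ | ⟨a, b, ha, hb, h⟩)
    · omega
    · obtain rfl : x = a := by omega
      obtain rfl : y = b := by omega
      exact h
  · exact fun h => Or.inr ⟨x, y, rfl, rfl, h⟩

/-- A computable search picks out of a decidable set a sequence along which a computable function
with infinite image strictly increases. -/
theorem exists_computable_strictMono {b : ℕ → Bool} {u : ℕ → ℕ} (hb : Computable b)
    (hu : Computable u) (hinf : (u '' {x | b x = true}).Infinite) :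
    ∃ e : ℕ → ℕ, Computable e ∧ (∀ n, b (e n) = true) ∧ StrictMono fun n => u (e n) := by
  have hex : ∀ v, ∃ x, (b x && decide (v < u x)) = true := by
    intro v
    obtain ⟨_, ⟨x, hx, rfl⟩, hlt⟩ := hinf.exists_gt v
    exact ⟨x, by simpa using ⟨hx, hlt⟩⟩
  have hsearch : Computable fun v => Nat.find (hex v) := by
    have hlt : Computable₂ fun v x : ℕ => decide (v < u x) :=
      Computable₂.comp (f := fun a c : ℕ => decide (a < c)) (Primrec.nat_lt.decide.to_comp)
        Computable.fst (hu.comp Computable.snd)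
    have hp : Computable₂ fun v x : ℕ => (b x && decide (v < u x)) :=
      Computable₂.comp (f := and) Primrec.and.to_comp (hb.comp Computable.snd) hlt
    refine (Partrec.rfind hp.partrec₂).of_eq_tot fun v => ?_
    rw [Nat.mem_rfind]
    refine ⟨?_, fun {m} hm => ?_⟩
    · simpa using Nat.find_spec (hex v)
    · simpa using Nat.find_min (hex v) hm
  let next : ℕ → ℕ := fun v => Nat.find (hex v)
  have hnext : ∀ v, b (next v) = true ∧ v < u (next v) := fun v => by
    have := Nat.find_spec (hex v)
    rwa [Bool.and_eq_true, decide_eq_true_eq] at this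
  refine ⟨fun n => Nat.rec (next 0) (fun _ x => next (u x)) n, ?_, ?_, ?_⟩
  · exact Computable.nat_rec Computable.id (Computable.const _)
      ((hsearch.comp (hu.comp (Computable.snd.comp Computable.snd))).to₂)
  · rintro (_ | n)
    · exact (hnext _).1
    · exact (hnext _).1
  · exact strictMono_nat_of_lt_succ fun n => (hnext _).2

/-- If `Id` does not reduce to `R`, then a reduction of `Id` to a relation whose even part is `R`
takes only finitely many even values. -/
theorem finite_even_of_reduction_id {R V : ℕ → ℕ → Prop} (hR : ¬ CompRed IdEq R)
    (hV : ∀ x y, V (2 * x) (2 * y) ↔ R x y) {w : ℕ → ℕ} (hw : Computable w)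
    (hred : ∀ x y, x = y ↔ V (w x) (w y)) : {n | w n % 2 = 0}.Finite := by
  by_contra hinf
  have hb : Computable fun n => decide (w n % 2 = 0) :=
    (Primrec.eq.decide.comp (Primrec.nat_mod.comp Primrec.id (Primrec.const 2))
      (Primrec.const 0)).to_comp.comp hw
  obtain ⟨e, he, hbe, hmono⟩ := exists_computable_strictMono hb Computable.id
    (by simpa using hinf)
  refine hR ⟨fun n => w (e n) / 2, ?_, fun x y => ?_⟩
  · exact (Primrec.nat_div.comp Primrec.id (Primrec.const 2)).to_comp.comp (hw.comp he)
  · have hx : 2 * (w (e x) / 2) = w (e x) := by have := hbe x; simp at this; omega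
    have hy : 2 * (w (e y) / 2) = w (e y) := by have := hbe y; simp at this; omega
    rw [← hV, hx, hy, ← hred]
    exact hmono.injective.eq_iff.symm

/-- If `Id` does not reduce to `R`, then a reduction of `R` to a relation whose odd part is `Id`
takes only finitely many odd values. -/
theorem finite_odd_of_reduction {R V : ℕ → ℕ → Prop} (hR : ¬ CompRed IdEq R)
    (hV : ∀ x y, V (2 * x + 1) (2 * y + 1) ↔ x = y) {w : ℕ → ℕ} (hw : Computable w)
    (hred : ∀ x y, R x y ↔ V (w x) (w y)) : (w '' {x | w x % 2 = 1}).Finite := by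
  by_contra hinf
  have hb : Computable fun n => decide (w n % 2 = 1) :=
    (Primrec.eq.decide.comp (Primrec.nat_mod.comp Primrec.id (Primrec.const 2))
      (Primrec.const 1)).to_comp.comp hw
  obtain ⟨e, he, hbe, hmono⟩ := exists_computable_strictMono hb hw (by simpa using hinf)
  refine hR ⟨e, he, fun x y => ?_⟩
  have hx : 2 * (w (e x) / 2) + 1 = w (e x) := by have := hbe x; simp at this; omega
  have hy : 2 * (w (e y) / 2) + 1 = w (e y) := by have := hbe y; simp at this; omega
  rw [hred, ← hx, ← hy, hV]
  have := hmono.injective.eq_iff (a := x) (b := y)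
  simp only [IdEq]
  omega

/-- A countable family of subsets has an injective family meeting every infinite member. -/
theorem exists_injective_forall_mem_of_infinite {ι α : Type*} [Encodable ι] [Infinite α]
    (I : ι → Set α) :
    ∃ i : ι → α, Function.Injective i ∧ ∀ s, (I s).Infinite → i s ∈ I s := by
  have step : ∀ (s : ι) (F : ∀ m : ι, Encodable.encode m < Encodable.encode s → α),
      ∃ a, ((I s).Infinite → a ∈ I s) ∧ ∀ m hm, F m hm ≠ a := by
    intro s F
    have hF : (Set.range fun m : {m // Encodable.encode m < Encodable.encode s} =>
        F m.1 m.2).Finite := by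
      have : Finite {m : ι // Encodable.encode m < Encodable.encode s} :=
        (Set.finite_Iio (Encodable.encode s)).preimage Encodable.encode_injective.injOn
      exact Set.finite_range _
    by_cases hs : (I s).Infinite
    · obtain ⟨a, ha, hna⟩ := hs.exists_notMem_finite hF
      exact ⟨a, fun _ => ha, fun m hm h => hna ⟨⟨m, hm⟩, h⟩⟩
    · obtain ⟨a, hna⟩ := hF.exists_notMem
      exact ⟨a, fun h => absurd h hs, fun m hm h => hna ⟨⟨m, hm⟩, h⟩⟩
  choose c hc hne using step
  let i : ι → α := (measure (Encodable.encode : ι → ℕ)).wf.fix c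
  have hi : ∀ s, i s = c s fun m _ => i m := fun s => WellFounded.fix_eq _ c s
  have hlt : ∀ m s : ι, Encodable.encode m < Encodable.encode s → i m ≠ i s := by
    intro m s hms
    rw [hi s]
    exact hne s (fun m _ => i m) m hms
  refine ⟨i, fun m s hms => ?_, fun s hs => ?_⟩
  · rcases lt_trichotomy (Encodable.encode m) (Encodable.encode s) with h | h | h
    · exact absurd hms (hlt m s h)
    · exact Encodable.encode_injective h
    · exact absurd hms.symm (hlt s m h)
  · rw [hi s]
    exact hc _ _ hs

/-- Only finitely many `n` can satisfy `T (f x) (g n)` for some `x`, when `T` lies below `R ⊕ Id`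
and `f`, `g` reduce `R`, `Id` to `T`. -/
theorem finite_overlap {R T : ℕ → ℕ → Prop} (hR : ¬ CompRed IdEq R) {f g h : ℕ → ℕ}
    (hf : Computable f) (hfT : ∀ x y, R x y ↔ T (f x) (f y))
    (hg : Computable g) (hgT : ∀ x y, IdEq x y ↔ T (g x) (g y))
    (hh : Computable h) (hhT : ∀ x y, T x y ↔ Join R IdEq (h x) (h y)) :
    {n | ∃ x, T (f x) (g n)}.Finite := by
  have hgJ : ∀ x y, x = y ↔ Join R IdEq (h (g x)) (h (g y)) := fun x y =>
    (hgT x y).trans (hhT _ _)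
  have h1 := finite_even_of_reduction_id hR (join_even R IdEq) (hh.comp hg) hgJ
  have h2 := finite_odd_of_reduction hR (join_odd R IdEq) (hh.comp hf) fun x y =>
    (hfT x y).trans (hhT _ _)
  have hinj : Set.InjOn (fun n => h (g n)) {n | h (g n) % 2 = 1} := by
    intro x hx y hy hxy
    simp only [Set.mem_ofPred_eq] at hx hxy
    rw [hgJ, ← hxy, show h (g x) = 2 * (h (g x) / 2) + 1 by omega, join_odd]
    rfl
  have h3 : {n | h (g n) % 2 = 1 ∧
      h (g n) ∈ (fun x => h (f x)) '' {x | h (f x) % 2 = 1}}.Finite := by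
    refine Set.Finite.of_finite_image (f := fun n => h (g n)) (h2.subset ?_)
      (hinj.mono fun n hn => hn.1)
    rintro _ ⟨n, hn, rfl⟩
    exact hn.2
  refine (h1.union h3).subset ?_
  rintro n ⟨x, hx⟩
  rcases (hhT _ _).1 hx with ⟨a, b, ha, hb, -⟩ | ⟨a, b, ha, hb, hab⟩
  · left
    simp only [Set.mem_ofPred_eq]
    omega
  · right
    simp only [IdEq] at hab
    refine ⟨by omega, x, ?_, ?_⟩
    · simp only [Set.mem_ofPred_eq]
      omega
    · simp only
      omega

theorem stmt_8 (R : ℕ → ℕ → Prop) (hR : Equivalence R) (hdark : Dark R) :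
    ∀ T : ℕ → ℕ → Prop, Equivalence T → ¬ IsLub' R IdEq T := by
  rintro T - ⟨⟨f, hf, hfT⟩, ⟨g, hg, hgT⟩, hlub⟩
  obtain ⟨hinf, hId⟩ := hdark
  have two_mul_comp : Computable fun x : ℕ => 2 * x :=
    (Primrec.nat_mul.comp (Primrec.const 2) Primrec.id).to_comp
  have two_mul_add_one_comp : Computable fun x : ℕ => 2 * x + 1 :=
    Computable.succ.comp two_mul_comp
  obtain ⟨h, hh, hhT⟩ : CompRed T (Join R IdEq) := by
    refine hlub _ ⟨fun x => ?_, fun {x y} => ?_, fun {x y z} => ?_⟩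
      ⟨_, two_mul_comp, fun x y => ?_⟩ ⟨_, two_mul_add_one_comp, fun x y => ?_⟩
    · rcases Nat.even_or_odd' x with ⟨a, rfl | rfl⟩
      · exact Or.inl ⟨a, a, rfl, rfl, hR.refl a⟩
      · exact Or.inr ⟨a, a, rfl, rfl, rfl⟩
    · rintro (⟨a, b, rfl, rfl, h⟩ | ⟨a, b, rfl, rfl, h⟩)
      · exact Or.inl ⟨b, a, rfl, rfl, hR.symm h⟩
      · exact Or.inr ⟨b, a, rfl, rfl, h.symm⟩
    · rintro (⟨a, b, rfl, rfl, h⟩ | ⟨a, b, rfl, rfl, h⟩)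
        (⟨a', b', h', rfl, k⟩ | ⟨a', b', h', rfl, k⟩)
      · obtain rfl : b = a' := by omega
        exact Or.inl ⟨a, b', rfl, rfl, hR.trans h k⟩
      · omega
      · omega
      · obtain rfl : b = a' := by omega
        exact Or.inr ⟨a, b', rfl, rfl, h.trans k⟩
    · exact (join_even R IdEq x y).symm
    · exact (join_odd R IdEq x y).symm
  have hB := finite_overlap hId hf hfT hg hgT hh hhT
  set B := {n | ∃ x, T (f x) (g n)}
  let cl : ℕ → Set ℕ := fun x => {z | R z x}
  have hcl : ∀ x y, cl x = cl y ↔ R x y := by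
    intro x y
    constructor
    · intro hxy
      have : x ∈ cl x := hR.refl x
      rwa [hxy] at this
    · intro hxy
      ext z
      exact ⟨fun hz => hR.trans hz hxy, fun hz => hR.trans hz (hR.symm hxy)⟩
  obtain ⟨i, hi, hiI⟩ := exists_injective_forall_mem_of_infinite fun s : Nat.Partrec.Code =>
    {j : ℕ | ∃ n ∉ B, 2 * j + 1 ∈ s.eval (g n)}
  obtain ⟨q, hq, hqY⟩ := exists_injective_forall_mem_of_infinite fun s : Nat.Partrec.Code =>
    {C : Set ℕ | ∃ x y, 2 * y ∈ s.eval (f x) ∧ C = cl y}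
  -- The class of an odd number is glued to the class `q s` when its index is `i s`.
  let d : ℕ → Set ℕ ⊕ ℕ := Function.extend i (fun s => Sum.inl (q s)) Sum.inr
  have hd_extend : ∀ s, d (i s) = Sum.inl (q s) := fun s => hi.extend_apply _ _ s
  have hd_inr : ∀ a, (¬ ∃ s, i s = a) → d a = Sum.inr a := fun a ha =>
    Function.extend_apply' _ _ a ha
  have hd : Function.Injective d := by
    intro a b hab
    by_cases ha : ∃ s, i s = a <;> by_cases hb : ∃ s, i s = b
    · obtain ⟨s, rfl⟩ := ha
      obtain ⟨t, rfl⟩ := hb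
      rw [hd_extend, hd_extend, Sum.inl.injEq] at hab
      rw [hq hab]
    · obtain ⟨s, rfl⟩ := ha
      rw [hd_extend, hd_inr b hb] at hab
      cases hab
    · obtain ⟨t, rfl⟩ := hb
      rw [hd_extend, hd_inr a ha] at hab
      cases hab
    · rw [hd_inr a ha, hd_inr b hb] at hab
      exact Sum.inr.inj hab
  let c : ℕ → Set ℕ ⊕ ℕ := fun a => if a % 2 = 0 then Sum.inl (cl (a / 2)) else d (a / 2)
  have hceven : ∀ x, c (2 * x) = Sum.inl (cl x) := fun x => by simp [c]
  have hcodd : ∀ x, c (2 * x + 1) = d x := fun x => by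
    simp only [c]
    rw [if_neg (by omega), show (2 * x + 1) / 2 = x by omega]
  have hUeven : ∀ x y, c (2 * x) = c (2 * y) ↔ R x y := fun x y => by
    rw [hceven, hceven, Sum.inl.injEq, hcl]
  have hUodd : ∀ x y, c (2 * x + 1) = c (2 * y + 1) ↔ x = y := fun x y => by
    rw [hcodd, hcodd, hd.eq_iff]
  obtain ⟨k, hk, hkT⟩ := hlub (fun a b => c a = c b) ⟨fun _ => rfl, Eq.symm, Eq.trans⟩
    ⟨_, two_mul_comp, fun x y => (hUeven x y).symm⟩
    ⟨_, two_mul_add_one_comp, fun x y => (hUodd x y).symm⟩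
  have hkf : ∀ x y, R x y ↔ c (k (f x)) = c (k (f y)) := fun x y => (hfT x y).trans (hkT _ _)
  have hkg : ∀ x y, x = y ↔ c (k (g x)) = c (k (g y)) := fun x y => (hgT x y).trans (hkT _ _)
  have hfin_even := finite_even_of_reduction_id (V := fun a b => c a = c b) hId hUeven
    (hk.comp hg) hkg
  have hfin_odd := finite_odd_of_reduction (V := fun a b => c a = c b) hId hUodd
    (hk.comp hf) hkf
  obtain ⟨s, hs⟩ := Nat.Partrec.Code.exists_code.1 (Partrec.nat_iff.1 hk.partrec)
  have heval : ∀ a b, b ∈ s.eval a ↔ b = k a := fun a b => by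
    rw [hs]
    exact Part.mem_some_iff
  have hI : {j : ℕ | ∃ n ∉ B, 2 * j + 1 ∈ s.eval (g n)}.Infinite := by
    intro hfin
    have hodd : {n | k (g n) % 2 = 1 ∧ n ∉ B}.Finite := by
      refine Set.Finite.of_finite_image (f := fun n => k (g n) / 2) (hfin.subset ?_) ?_
      · rintro _ ⟨n, ⟨hn, hnB⟩, rfl⟩
        exact ⟨n, hnB, (heval _ _).2 (by simp only; omega)⟩
      · rintro x ⟨hx, -⟩ y ⟨hy, -⟩ hxy
        rw [hkg, show k (g x) = k (g y) by simp only at hxy; omega]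
    refine Set.infinite_univ (((hB.union hfin_even).union hodd).subset fun n _ => ?_)
    by_cases hnB : n ∈ B
    · exact Or.inl (Or.inl hnB)
    · rcases Nat.mod_two_eq_zero_or_one (k (g n)) with hn | hn
      · exact Or.inl (Or.inr hn)
      · exact Or.inr ⟨hn, hnB⟩
  have hY : {C : Set ℕ | ∃ x y, 2 * y ∈ s.eval (f x) ∧ C = cl y}.Infinite := by
    intro hfin
    apply hinf
    refine (((hfin.image Sum.inl).union (hfin_odd.image c)).image
      fun v => {z | c (k (f z)) = v}).subset ?_
    rintro _ ⟨x, rfl⟩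
    refine ⟨c (k (f x)), ?_, ?_⟩
    · rcases Nat.mod_two_eq_zero_or_one (k (f x)) with hx | hx
      · left
        have hx' : k (f x) = 2 * (k (f x) / 2) := by omega
        refine ⟨cl (k (f x) / 2), ⟨x, k (f x) / 2, ?_, rfl⟩, ?_⟩
        · rw [heval, ← hx']
        · rw [hx', hceven, ← hx']
      · exact Or.inr ⟨k (f x), ⟨x, hx, rfl⟩, rfl⟩
    · ext z
      exact (hkf z x).symm
  obtain ⟨n, hn, hin⟩ := hiI s hI
  obtain ⟨x, y, hxy, hqy⟩ := hqY s hY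
  rw [heval] at hin hxy
  refine hn ⟨x, (hkT _ _).2 ?_⟩
  simp only
  rw [← hin, ← hxy, hceven, hcodd, ← hqy]
  exact (hd_extend s).symm
end

section
/- For every equivalence relation R on ℕ with infinitely many equivalence classes, there exists an equivalence relation S on ℕ with infinitely many equivalence classes such that R and S have no least upper bound: no equivalence relation T on ℕ is a least upper bound of R and S. -/
/-- A countable family of sets in Baire space, each of which contains a cylinder inside every
cylinder, has a common element. -/
theorem exists_forall_mem_of_cylinder_dense {ι : Type*} [Countable ι] (D : ι → Set (ℕ → ℕ))
    (hD : ∀ i (g : ℕ → ℕ) (n : ℕ), ∃ g' : ℕ → ℕ, ∃ m, (∀ k < n, g' k = g k) ∧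
      ∀ h : ℕ → ℕ, (∀ k < m, h k = g' k) → h ∈ D i) :
    ∃ h, ∀ i, h ∈ D i := by
  have hdense : Dense (⋂ i, interior (D i)) := by
    refine dense_iInter_of_isOpen (fun _ => isOpen_interior) fun i => ?_
    rw [(PiNat.isTopologicalBasis_cylinders (fun _ : ℕ => ℕ)).dense_iff]
    rintro _ ⟨g, n, rfl⟩ -
    obtain ⟨g', m, hg, hm⟩ := hD i g n
    refine ⟨g', hg, mem_interior.2 ⟨PiNat.cylinder g' m, fun h hh => hm h hh,
      PiNat.isOpen_cylinder _ _ _, PiNat.self_mem_cylinder _ _⟩⟩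
  obtain ⟨h, hh⟩ := hdense.nonempty
  exact ⟨h, fun i => interior_subset (Set.mem_iInter.1 hh i)⟩

instance countable_computable_s9 : Countable {f : ℕ → ℕ // Computable f} := by
  have hcode (f : {f : ℕ → ℕ // Computable f}) :
      ∃ c : Nat.Partrec.Code, c.eval = fun n => Part.some (f.1 n) :=
    Nat.Partrec.Code.exists_code.1 (Partrec.nat_iff.1 f.2.partrec)
  choose c hc using hcode
  refine Function.Injective.countable (f := c) fun f g hfg => Subtype.ext (funext fun n => ?_)
  have h := congrFun ((hc f).symm.trans ((congrArg _ hfg).trans (hc g))) n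
  exact Part.some_inj.1 h

/-- An equivalence relation with infinitely many classes is the kernel of a function with
infinite range. -/
theorem exists_label {R : ℕ → ℕ → Prop} (hR : Equivalence R) (hinf : (classes R).Infinite) :
    ∃ r : ℕ → ℕ, (∀ x y, R x y ↔ r x = r y) ∧ (Set.range r).Infinite := by
  have hmem (x) : R (sInf {z | R z x}) x := Nat.sInf_mem (s := {z | R z x}) ⟨x, hR.refl x⟩
  have hiff (x y) : R x y ↔ sInf {z | R z x} = sInf {z | R z y} := by
    refine ⟨fun h => ?_, fun h => ?_⟩
    · congr 1
      ext z
      exact ⟨fun hz => hR.trans hz h, fun hz => hR.trans hz (hR.symm h)⟩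
    · have hx := hmem x
      rw [h] at hx
      exact hR.trans (hR.symm hx) (hmem y)
  refine ⟨fun x => sInf {z | R z x}, hiff, fun hfin => hinf ?_⟩
  refine (hfin.image fun a => {z | R z a}).subset ?_
  rintro _ ⟨a, rfl⟩
  refine ⟨_, ⟨a, rfl⟩, ?_⟩
  ext z
  exact ⟨fun hz => hR.trans hz (hmem a), fun hz => hR.trans hz (hR.symm (hmem a))⟩

theorem classes_infinite_of_unbounded {g : ℕ → ℕ} (hg : ∀ k, ∃ x, k ≤ g x) :
    (classes fun x y => g x = g y).Infinite := by
  have hrange : (Set.range g).Infinite := by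
    refine Set.infinite_of_not_bddAbove fun ⟨b, hb⟩ => ?_
    obtain ⟨x, hx⟩ := hg (b + 1)
    have := hb ⟨x, rfl⟩
    omega
  intro hfin
  refine hrange (Set.Finite.of_finite_image (f := fun v => {z | g z = v}) (hfin.subset ?_) ?_)
  · rintro _ ⟨_, ⟨a, rfl⟩, rfl⟩
    exact ⟨a, rfl⟩
  · rintro _ ⟨a, rfl⟩ w - h
    exact (Set.ext_iff.1 h a).1 rfl

/-- For every `r`, a function `g` whose kernel is generic relative to the kernel of `r`. A
computable `F` codes the decidable set where it is even (or odd) together with the map `F / 2`. -/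
theorem exists_generic_label (r : ℕ → ℕ) :
    ∃ g : ℕ → ℕ, ∀ F : ℕ → ℕ, Computable F →
      (∀ k, {x | F x % 2 = 1}.Infinite → ∃ x, F x % 2 = 1 ∧ k ≤ g x) ∧
      ({x | F x % 2 = 0}.Infinite → ∃ x y, F x % 2 = 0 ∧ F y % 2 = 0 ∧
        ¬ (g x = g y ↔ r (F x / 2) = r (F y / 2))) ∧
      ((r '' {x | F x % 2 = 1}).Infinite → ∃ x y, F x % 2 = 1 ∧ F y % 2 = 1 ∧
        ¬ (r x = r y ↔ g (F x / 2) = g (F y / 2))) := by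
  have hgeneric := exists_forall_mem_of_cylinder_dense
    (ι := {f : ℕ → ℕ // Computable f} × (ℕ ⊕ Bool))
    (fun i => {g | match i.2 with
      | .inl k => {x | i.1.1 x % 2 = 1}.Infinite → ∃ x, i.1.1 x % 2 = 1 ∧ k ≤ g x
      | .inr true => {x | i.1.1 x % 2 = 0}.Infinite →
          ∃ x y, i.1.1 x % 2 = 0 ∧ i.1.1 y % 2 = 0 ∧
            ¬ (g x = g y ↔ r (i.1.1 x / 2) = r (i.1.1 y / 2))
      | .inr false => (r '' {x | i.1.1 x % 2 = 1}).Infinite →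
          ∃ x y, i.1.1 x % 2 = 1 ∧ i.1.1 y % 2 = 1 ∧
            ¬ (r x = r y ↔ g (i.1.1 x / 2) = g (i.1.1 y / 2))})
  refine (hgeneric ?_).elim fun g₁ h₁ => ?_
  rotate_left
  · exact ⟨g₁, fun F hF => ⟨fun k => h₁ (⟨F, hF⟩, .inl k), h₁ (⟨F, hF⟩, .inr true),
      h₁ (⟨F, hF⟩, .inr false)⟩⟩
  rintro ⟨⟨F, hF⟩, k | _ | _⟩ g n
  · by_cases hinf : {x | F x % 2 = 1}.Infinite
    · obtain ⟨x, hx, hnx⟩ := hinf.exists_gt n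
      refine ⟨Function.update g x k, x + 1, fun i hi => ?_, fun h hh _ => ⟨x, hx, ?_⟩⟩
      · exact Function.update_of_ne (by omega) _ _
      · simp [hh x (by omega)]
    · exact ⟨g, 0, fun _ _ => rfl, fun h _ hi => absurd hi hinf⟩
  · by_cases hinf : (r '' {x | F x % 2 = 1}).Infinite
    · have hsec : ∀ v ∈ r '' {x | F x % 2 = 1}, ∃ x, F x % 2 = 1 ∧ r x = v := fun v hv => hv
      choose! s hs using hsec
      obtain ⟨v, hv, w, hw, hvw, heq⟩ := hinf.exists_ne_map_eq_of_mapsTo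
        (f := fun v => min (F (s v) / 2) n) (t := Set.Iic n)
        (fun v _ => Set.mem_Iic.2 (min_le_right _ _)) (Set.finite_Iic n)
      refine ⟨fun k => if k < n then g k else 0, max (F (s v) / 2) (F (s w) / 2) + 1,
        fun i hi => by simp [hi], fun h hh _ => ⟨s v, s w, (hs v hv).1, (hs w hw).1, ?_⟩⟩
      rw [(hs v hv).2, (hs w hw).2, hh (F (s v) / 2) (by omega), hh (F (s w) / 2) (by omega)]
      have : F (s v) / 2 = F (s w) / 2 ∨ (n ≤ F (s v) / 2 ∧ n ≤ F (s w) / 2) := by omega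
      rcases this with h | ⟨h, h'⟩
      · simp [hvw, h]
      · simp [hvw, Nat.not_lt.2 h, Nat.not_lt.2 h']
    · exact ⟨g, 0, fun _ _ => rfl, fun h _ hi => absurd hi hinf⟩
  · by_cases hinf : {x | F x % 2 = 0}.Infinite
    · obtain ⟨x, hx, hnx⟩ := hinf.exists_gt n
      obtain ⟨y, hy, hxy⟩ := hinf.exists_gt x
      by_cases hr : r (F x / 2) = r (F y / 2)
      · refine ⟨fun k => if k < n then g k else k, y + 1,
          fun i hi => by simp [hi], fun h hh _ => ⟨x, y, hx, hy, ?_⟩⟩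
        rw [hh x (by omega), hh y (by omega)]
        simp [hr, Nat.not_lt.2 hnx.le, Nat.not_lt.2 (hnx.trans hxy).le, hxy.ne]
      · refine ⟨fun k => if k < n then g k else 0, y + 1,
          fun i hi => by simp [hi], fun h hh _ => ⟨x, y, hx, hy, ?_⟩⟩
        rw [hh x (by omega), hh y (by omega)]
        simp [hr, Nat.not_lt.2 hnx.le, Nat.not_lt.2 (hnx.trans hxy).le]
    · exact ⟨g, 0, fun _ _ => rfl, fun h _ hi => absurd hi hinf⟩

/-- The injection `ℕ → ℕ ⊕ ℕ` sending `j` to `h j` on the left if `h` takes this value at `j`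
for the first time, and to `j` on the right otherwise. -/
def firstOccurrence (h : ℕ → ℕ) (j : ℕ) : ℕ ⊕ ℕ :=
  if ∀ k < j, h k ≠ h j then .inl (h j) else .inr j

theorem firstOccurrence_injective (h : ℕ → ℕ) : Function.Injective (firstOccurrence h) := by
  intro i j hij
  unfold firstOccurrence at hij
  split_ifs at hij with hi hj
  · have heq := Sum.inl.inj hij
    rcases lt_trichotomy i j with hlt | rfl | hlt
    · exact absurd heq (hj i hlt)
    · rfl
    · exact absurd heq.symm (hi j hlt)
  · exact Sum.inr.inj hij

theorem firstOccurrence_congr {h h' : ℕ → ℕ} {j : ℕ} (hh : ∀ k ≤ j, h k = h' k) :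
    firstOccurrence h j = firstOccurrence h' j := by
  have : (∀ k < j, h k ≠ h j) ↔ ∀ k < j, h' k ≠ h' j :=
    forall₂_congr fun k hk => by rw [hh k hk.le, hh j le_rfl]
  unfold firstOccurrence
  simp only [this]
  rw [hh j le_rfl]

/-- Labels of the quotient of the join of the kernels of `r` and `g` that glues classes
according to `firstOccurrence h`. -/
def glueLabel (r g h : ℕ → ℕ) (a : ℕ) : ℕ ⊕ ℕ :=
  if a % 2 = 0 then .inl (r (a / 2)) else firstOccurrence h (g (a / 2))

theorem glueLabel_even (r g h : ℕ → ℕ) {a : ℕ} (ha : a % 2 = 0) :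
    glueLabel r g h a = .inl (r (a / 2)) := if_pos ha

theorem glueLabel_odd (r g h : ℕ → ℕ) {a : ℕ} (ha : a % 2 = 1) :
    glueLabel r g h a = firstOccurrence h (g (a / 2)) := if_neg (by omega)

theorem glueLabel_congr {r g h h' : ℕ → ℕ} {a : ℕ} (hh : ∀ k ≤ g (a / 2), h k = h' k) :
    glueLabel r g h a = glueLabel r g h' a := by
  simp only [glueLabel, firstOccurrence_congr hh]

/-- If `T` reduces to every gluing of the kernels of `r` and `g`, then a single computable
function reduces `T` to all gluings given by functions in some cylinder. -/
theorem exists_uniform_reduction {r g : ℕ → ℕ} {T : ℕ → ℕ → Prop}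
    (hT : ∀ h, CompRed T fun a b => glueLabel r g h a = glueLabel r g h b) :
    ∃ f : ℕ → ℕ, Computable f ∧ ∃ (h₀ : ℕ → ℕ) (n : ℕ), ∀ h : ℕ → ℕ, (∀ k < n, h k = h₀ k) →
      ∀ x y, T x y ↔ glueLabel r g h (f x) = glueLabel r g h (f y) := by
  by_contra! hcon
  obtain ⟨h, hh⟩ := exists_forall_mem_of_cylinder_dense
    (fun f : {f : ℕ → ℕ // Computable f} =>
      {h | ∃ x y, ¬ (T x y ↔ glueLabel r g h (f.1 x) = glueLabel r g h (f.1 y))})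
    (by
      rintro ⟨f, hf⟩ h₀ n
      obtain ⟨h, hn, x, y, hxy⟩ := hcon f hf h₀ n
      refine ⟨h, max (g (f x / 2)) (g (f y / 2)) + 1, hn, fun h' hh' => ⟨x, y, ?_⟩⟩
      rw [glueLabel_congr (a := f x) fun k hk => hh' k (by omega),
        glueLabel_congr (a := f y) fun k hk => hh' k (by omega)]
      tauto)
  obtain ⟨f, hf, hred⟩ := hT h
  obtain ⟨x, y, hxy⟩ := hh ⟨f, hf⟩
  exact hxy (hred x y)

/-- A uniform reduction to all gluings in a cylinder meets only finitely many classes of one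
of the two sides. -/
theorem uniform_reduction_one_sided {r g f h₀ : ℕ → ℕ} {n : ℕ} {T : ℕ → ℕ → Prop}
    (hf : ∀ h : ℕ → ℕ, (∀ k < n, h k = h₀ k) →
      ∀ x y, T x y ↔ glueLabel r g h (f x) = glueLabel r g h (f y)) :
    (∀ x, f x % 2 = 1 → g (f x / 2) < n) ∨
      ∀ x, f x % 2 = 0 → r (f x / 2) ∈ h₀ '' Set.Iio n := by
  by_contra! hcon
  obtain ⟨⟨x, hx, hxn⟩, y, hy, hyn⟩ := hcon
  set j := g (f x / 2)
  set i := r (f y / 2)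
  have hne : ∀ k < n, h₀ k ≠ i := fun k hk heq => hyn ⟨k, hk, heq⟩
  have hglued := hf (fun k => if k < n then h₀ k else if k = j then i else i + 1)
    (fun k hk => by simp [hk]) x y
  have hapart := hf (fun k => if k < n then h₀ k else i + 1) (fun k hk => by simp [hk]) x y
  rw [glueLabel_odd _ _ _ hx, glueLabel_even _ _ _ hy] at hglued hapart
  have hjn : ¬ j < n := Nat.not_lt.2 hxn
  have hfirst : ∀ k < j, (if k < n then h₀ k else if k = j then i else i + 1) ≠ i := by
    intro k hk
    split_ifs with hkn hkj
    · exact hne k hkn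
    · omega
    · omega
  have hTxy : T x y := hglued.2 (by
    change firstOccurrence _ j = .inl i
    simp only [firstOccurrence, hjn, if_false, if_true]
    exact if_pos hfirst)
  have heq := hapart.1 hTxy
  change firstOccurrence _ j = .inl i at heq
  simp only [firstOccurrence, hjn, if_false] at heq
  split_ifs at heq
  exact absurd (Sum.inl.inj heq) (by omega)

theorem stmt_9 (R : ℕ → ℕ → Prop) (hR : Equivalence R) (hinf : (classes R).Infinite) :
    ∃ S : ℕ → ℕ → Prop, Equivalence S ∧ (classes S).Infinite ∧
      ∀ T : ℕ → ℕ → Prop, Equivalence T → ¬ IsLub' R S T := by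
  obtain ⟨r, hr, hrange⟩ := exists_label hR hinf
  obtain ⟨g, hg⟩ := exists_generic_label r
  refine ⟨fun x y => g x = g y, eq_equivalence.comap g, ?_, ?_⟩
  · refine classes_infinite_of_unbounded fun k => ?_
    obtain ⟨x, -, hx⟩ := (hg (fun _ => 1) (Computable.const 1)).1 k (by simp [Set.infinite_univ])
    exact ⟨x, hx⟩
  rintro T - ⟨⟨p, hp, hRT⟩, ⟨q, hq, hST⟩, hleast⟩
  have hdouble : Computable fun x : ℕ => 2 * x :=
    (Primrec.nat_mul.comp (Primrec.const 2) Primrec.id).to_comp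
  have hT (h : ℕ → ℕ) : CompRed T fun a b => glueLabel r g h a = glueLabel r g h b := by
    refine hleast _ (eq_equivalence.comap _) ⟨fun x => 2 * x, hdouble, fun x y => ?_⟩
      ⟨fun x => 2 * x + 1, Computable.succ.comp hdouble, fun x y => ?_⟩
    · beta_reduce
      rw [glueLabel_even _ _ _ (Nat.mul_mod_right 2 x),
        glueLabel_even _ _ _ (Nat.mul_mod_right 2 y), hr]
      simp
    · beta_reduce
      rw [glueLabel_odd _ _ _ (show (2 * x + 1) % 2 = 1 by omega),
        glueLabel_odd _ _ _ (show (2 * y + 1) % 2 = 1 by omega),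
        (firstOccurrence_injective h).eq_iff, show (2 * x + 1) / 2 = x by omega,
        show (2 * y + 1) / 2 = y by omega]
  obtain ⟨f, hf, h₀, n, hred⟩ := exists_uniform_reduction hT
  have hred₀ := hred h₀ fun _ _ => rfl
  have heven {x y} (hx : f x % 2 = 0) (hy : f y % 2 = 0) :
      T x y ↔ r (f x / 2) = r (f y / 2) := by
    rw [hred₀, glueLabel_even _ _ _ hx, glueLabel_even _ _ _ hy, Sum.inl.injEq]
  have hodd {x y} (hx : f x % 2 = 1) (hy : f y % 2 = 1) :
      T x y ↔ g (f x / 2) = g (f y / 2) := by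
    rw [hred₀, glueLabel_odd _ _ _ hx, glueLabel_odd _ _ _ hy,
      (firstOccurrence_injective h₀).eq_iff]
  rcases uniform_reduction_one_sided hred with hside | hside
  · obtain ⟨hunb, havoid, -⟩ := hg _ (hf.comp hq)
    have hfin : {x | f (q x) % 2 = 1}.Finite := by
      by_contra hB
      have himage : (g '' {x | f (q x) % 2 = 1}).Finite := by
        by_contra hI
        have hsec : ∀ v ∈ g '' {x | f (q x) % 2 = 1}, ∃ x, f (q x) % 2 = 1 ∧ g x = v :=
          fun v hv => hv
        choose! s hs using hsec
        obtain ⟨v, hv, w, hw, hvw, heq⟩ := Set.Infinite.exists_ne_map_eq_of_mapsTo hI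
          (f := fun v => g (f (q (s v)) / 2)) (t := Set.Iio n)
          (fun v hv => hside _ (hs v hv).1) (Set.finite_Iio n)
        refine hvw ?_
        rw [← (hs v hv).2, ← (hs w hw).2]
        exact (hST _ _).2 ((hodd (hs v hv).1 (hs w hw).1).2 heq)
      obtain ⟨b, hb⟩ := himage.bddAbove
      obtain ⟨x, hx, hbx⟩ := hunb (b + 1) hB
      have := hb ⟨x, hx, rfl⟩
      omega
    obtain ⟨x, y, hx, hy, hxy⟩ := havoid (by
      refine hfin.infinite_compl.mono fun x hx => ?_
      simp only [Set.mem_compl_iff, Set.mem_ofPred_eq] at hx ⊢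
      omega)
    exact hxy ((hST x y).trans (heven hx hy))
  · obtain ⟨-, -, havoid⟩ := hg _ (hf.comp hp)
    have hfin : (r '' {x | f (p x) % 2 = 0}).Finite := by
      by_contra hI
      have hsec : ∀ v ∈ r '' {x | f (p x) % 2 = 0}, ∃ x, f (p x) % 2 = 0 ∧ r x = v :=
        fun v hv => hv
      choose! s hs using hsec
      obtain ⟨v, hv, w, hw, hvw, heq⟩ := Set.Infinite.exists_ne_map_eq_of_mapsTo hI
        (f := fun v => r (f (p (s v)) / 2)) (t := h₀ '' Set.Iio n)
        (fun v hv => hside _ (hs v hv).1) ((Set.finite_Iio n).image _)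
      refine hvw ?_
      rw [← (hs v hv).2, ← (hs w hw).2, ← hr]
      exact (hRT _ _).2 ((heven (hs v hv).1 (hs w hw).1).2 heq)
    obtain ⟨x, y, hx, hy, hxy⟩ := havoid (by
      refine (hrange.sdiff hfin).mono ?_
      rintro _ ⟨⟨x, rfl⟩, hx⟩
      refine ⟨x, ?_, rfl⟩
      by_contra hne
      refine hx ⟨x, ?_, rfl⟩
      simp only [Set.mem_ofPred_eq] at hne ⊢
      omega)
    exact hxy (((hr x y).symm.trans (hRT x y)).trans (hodd hx hy))
end

section
/- There exist equivalence relations R and S on ℕ, each with infinitely many equivalence classes, such that ¬(R ≤c S), ¬(S ≤c R), and R and S have a least upper bound: some equivalence relation T on ℕ is a least upper bound of R and S. -/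
theorem CompRed.trans {R S T : ℕ → ℕ → Prop} (hRS : CompRed R S) (hST : CompRed S T) :
    CompRed R T := by
  obtain ⟨f, hf, hfR⟩ := hRS
  obtain ⟨g, hg, hgS⟩ := hST
  exact ⟨g ∘ f, hg.comp hf, fun x y => (hfR x y).trans (hgS _ _)⟩

theorem Join.even_even {R S : ℕ → ℕ → Prop} {x y : ℕ} :
    Join R S (2 * x) (2 * y) ↔ R x y := by
  constructor
  · rintro (⟨a, b, ha, hb, h⟩ | ⟨a, b, ha, hb, h⟩)
    · obtain rfl : x = a := by omega
      obtain rfl : y = b := by omega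
      exact h
    · omega
  · exact fun h => Or.inl ⟨x, y, rfl, rfl, h⟩

theorem Join.odd_odd {R S : ℕ → ℕ → Prop} {x y : ℕ} :
    Join R S (2 * x + 1) (2 * y + 1) ↔ S x y := by
  constructor
  · rintro (⟨a, b, ha, hb, h⟩ | ⟨a, b, ha, hb, h⟩)
    · omega
    · obtain rfl : x = a := by omega
      obtain rfl : y = b := by omega
      exact h
  · exact fun h => Or.inr ⟨x, y, rfl, rfl, h⟩

theorem Join.not_even_odd {R S : ℕ → ℕ → Prop} {x y : ℕ} :
    ¬ Join R S (2 * x) (2 * y + 1) := by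
  rintro (⟨a, b, ha, hb, -⟩ | ⟨a, b, ha, hb, -⟩) <;> omega

theorem Join.not_odd_even {R S : ℕ → ℕ → Prop} {x y : ℕ} :
    ¬ Join R S (2 * x + 1) (2 * y) := by
  rintro (⟨a, b, ha, hb, -⟩ | ⟨a, b, ha, hb, -⟩) <;> omega

theorem Equivalence.join {R S : ℕ → ℕ → Prop} (hR : Equivalence R) (hS : Equivalence S) :
    Equivalence (Join R S) where
  refl x := by
    obtain ⟨k, rfl | rfl⟩ := x.even_or_odd'
    · exact Join.even_even.2 (hR.refl k)
    · exact Join.odd_odd.2 (hS.refl k)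
  symm := by
    rintro _ _ (⟨x, y, rfl, rfl, h⟩ | ⟨x, y, rfl, rfl, h⟩)
    · exact Join.even_even.2 (hR.symm h)
    · exact Join.odd_odd.2 (hS.symm h)
  trans := by
    rintro _ _ z (⟨x, y, rfl, rfl, h⟩ | ⟨x, y, rfl, rfl, h⟩) hz <;>
      obtain ⟨k, rfl | rfl⟩ := z.even_or_odd'
    · exact Join.even_even.2 (hR.trans h (Join.even_even.1 hz))
    · exact (Join.not_even_odd hz).elim
    · exact (Join.not_odd_even hz).elim
    · exact Join.odd_odd.2 (hS.trans h (Join.odd_odd.1 hz))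

theorem computable_two_mul : Computable fun x : ℕ => 2 * x :=
  (Primrec.nat_mul.comp (Primrec.const 2) Primrec.id).to_comp

theorem computable_two_mul_add_one : Computable fun x : ℕ => 2 * x + 1 :=
  Computable.succ.comp computable_two_mul

theorem compRed_join_left (R S : ℕ → ℕ → Prop) : CompRed R (Join R S) :=
  ⟨_, computable_two_mul, fun _ _ => Join.even_even.symm⟩

theorem compRed_join_right (R S : ℕ → ℕ → Prop) : CompRed S (Join R S) :=
  ⟨_, computable_two_mul_add_one, fun _ _ => Join.odd_odd.symm⟩

/-- Two reductions into `U` whose images are `U`-inequivalent combine into a reduction of the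
uniform join. -/
theorem join_compRed {R S U : ℕ → ℕ → Prop} (hU : Equivalence U) {f g : ℕ → ℕ}
    (hf : Computable f) (hg : Computable g) (hfR : ∀ x y, R x y ↔ U (f x) (f y))
    (hgS : ∀ x y, S x y ↔ U (g x) (g y)) (hfg : ∀ x y, ¬ U (f x) (g y)) :
    CompRed (Join R S) U := by
  refine ⟨fun z => cond z.bodd (g z.div2) (f z.div2),
    Computable.cond Primrec.nat_bodd.to_comp (hg.comp Primrec.nat_div2.to_comp)
      (hf.comp Primrec.nat_div2.to_comp), fun x y => ?_⟩
  have even_bodd (k : ℕ) : (2 * k).bodd = false := by simp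
  have even_div2 (k : ℕ) : (2 * k).div2 = k := by rw [Nat.div2_val]; omega
  have odd_bodd (k : ℕ) : (2 * k + 1).bodd = true := by simp
  have odd_div2 (k : ℕ) : (2 * k + 1).div2 = k := by rw [Nat.div2_val]; omega
  obtain ⟨a, rfl | rfl⟩ := x.even_or_odd' <;> obtain ⟨b, rfl | rfl⟩ := y.even_or_odd' <;>
    simp only [even_bodd, even_div2, odd_bodd, odd_div2, cond_true, cond_false]
  · exact Join.even_even.trans (hfR a b)
  · exact iff_of_false Join.not_even_odd (hfg a b)
  · exact iff_of_false Join.not_odd_even fun h => hfg b a (hU.symm h)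
  · exact Join.odd_odd.trans (hgS a b)

theorem infinite_classes_of_compRed_idEq {R : ℕ → ℕ → Prop} (hR : Equivalence R)
    (h : CompRed IdEq R) : (classes R).Infinite := by
  obtain ⟨f, -, hf⟩ := h
  refine Set.infinite_of_injective_forall_mem (f := fun x => {z | R z (f x)}) ?_
    fun x => ⟨f x, rfl⟩
  intro x y hxy
  have hx : f x ∈ {z | R z (f y)} := by
    rw [← show {z | R z (f x)} = {z | R z (f y)} from hxy]
    exact hR.refl (f x)
  exact (hf x y).2 hx

theorem equivalence_idEq : Equivalence IdEq := ⟨fun _ => rfl, Eq.symm, Eq.trans⟩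

/-- There is a set which is not the preimage of any `R`-class under a computable function. -/
theorem exists_ne_preimage_class (R : ℕ → ℕ → Prop) :
    ∃ B : Set ℕ, ∀ g : ℕ → ℕ, Computable g → ∀ k, B ≠ {x | R (g x) k} := by
  let F : {f : ℕ → ℕ // Computable f} × ℕ → Set ℕ := fun p => {x | R (p.1.1 x) p.2}
  have hF : ¬ Function.Surjective F := fun h => by
    have : Nonempty {f : ℕ → ℕ // Computable f} := ⟨⟨id, Computable.id⟩⟩
    obtain ⟨e, he⟩ := exists_surjective_nat ({f : ℕ → ℕ // Computable f} × ℕ)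
    exact Function.cantor_surjective (F ∘ e) (h.comp he)
  simp only [Function.Surjective, not_forall] at hF
  obtain ⟨B, hB⟩ := hF
  exact ⟨B, fun g hg k h => hB ⟨(⟨g, hg⟩, k), h.symm⟩⟩

/-- The equivalence relation with classes `B` and `Bᶜ`. -/
def SetEquiv (B : Set ℕ) : ℕ → ℕ → Prop := fun x y => x ∈ B ↔ y ∈ B

theorem equivalence_setEquiv (B : Set ℕ) : Equivalence (SetEquiv B) :=
  ⟨fun _ => Iff.rfl, Iff.symm, Iff.trans⟩

/-- The uniform join of infinitely many copies of `SetEquiv A`. -/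
def Columns (A : Set ℕ) : ℕ → ℕ → Prop := fun x y =>
  x.unpair.1 = y.unpair.1 ∧ SetEquiv A x.unpair.2 y.unpair.2

theorem equivalence_columns (A : Set ℕ) : Equivalence (Columns A) :=
  ⟨fun _ => ⟨rfl, Iff.rfl⟩, fun h => ⟨h.1.symm, h.2.symm⟩,
    fun h h' => ⟨h.1.trans h'.1, h.2.trans h'.2⟩⟩

theorem columns_pair {A : Set ℕ} {m n x y : ℕ} :
    Columns A (Nat.pair m x) (Nat.pair n y) ↔ m = n ∧ SetEquiv A x y := by
  simp [Columns]

theorem computable_pair_left (n : ℕ) : Computable (Nat.pair n) :=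
  (Primrec₂.natPair.comp (Primrec.const n) Primrec.id).to_comp

theorem idEq_compRed_columns (A : Set ℕ) : CompRed IdEq (Columns A) :=
  ⟨fun n => Nat.pair n 0, (Primrec₂.natPair.comp Primrec.id (Primrec.const 0)).to_comp,
    fun x y => by simp [columns_pair, IdEq, SetEquiv]⟩

/-- Under a reduction of `Columns A` to `U`, only finitely many columns meet a given `U`-class. -/
theorem Columns.exists_avoid {A : Set ℕ} {U : ℕ → ℕ → Prop} (hU : Equivalence U) {f : ℕ → ℕ}
    (hf : ∀ x y, Columns A x y ↔ U (f x) (f y)) {P : Set ℕ} (hP : ∀ p ∈ P, ∀ q ∈ P, U p q) :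
    ∃ N, ∀ z, N ≤ z.unpair.1 → ∀ p ∈ P, ¬ U (f z) p := by
  by_cases h : ∃ z, ∃ p ∈ P, U (f z) p
  · obtain ⟨w, q, hq, hwq⟩ := h
    refine ⟨w.unpair.1 + 1, fun z hz p hp hzp => ?_⟩
    have := ((hf z w).2 (hU.trans hzp (hU.trans (hP p hp q hq) (hU.symm hwq)))).1
    omega
  · push Not at h
    exact ⟨0, fun z _ => h z⟩

theorem Columns.exists_avoid_setEquiv {A B : Set ℕ} {U : ℕ → ℕ → Prop} (hU : Equivalence U)
    {f g : ℕ → ℕ} (hf : ∀ x y, Columns A x y ↔ U (f x) (f y))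
    (hg : ∀ x y, SetEquiv B x y ↔ U (g x) (g y)) :
    ∃ N, ∀ z, N ≤ z.unpair.1 → ∀ y, ¬ U (f z) (g y) := by
  obtain ⟨M, hM⟩ := Columns.exists_avoid hU hf (P := g '' B) <| by
    rintro _ ⟨x, hx, rfl⟩ _ ⟨y, hy, rfl⟩
    exact (hg x y).1 (iff_of_true hx hy)
  obtain ⟨N, hN⟩ := Columns.exists_avoid hU hf (P := g '' Bᶜ) <| by
    rintro _ ⟨x, hx, rfl⟩ _ ⟨y, hy, rfl⟩
    exact (hg x y).1 (iff_of_false hx hy)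
  refine ⟨max M N, fun z hz y => ?_⟩
  by_cases hy : y ∈ B
  · exact hM z (le_of_max_le_left hz) _ ⟨y, hy, rfl⟩
  · exact hN z (le_of_max_le_right hz) _ ⟨y, hy, rfl⟩

theorem join_columns_setEquiv_compRed {A B : Set ℕ} {U : ℕ → ℕ → Prop} (hU : Equivalence U)
    (hA : CompRed (Columns A) U) (hB : CompRed (SetEquiv B) U) :
    CompRed (Join (Columns A) (SetEquiv B)) U := by
  obtain ⟨f, hf, hfU⟩ := hA
  obtain ⟨g, hg, hgU⟩ := hB
  obtain ⟨N, hN⟩ := Columns.exists_avoid_setEquiv hU hfU hgU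
  have shift_computable : Computable fun z : ℕ => Nat.pair (z.unpair.1 + N) z.unpair.2 :=
    (Primrec₂.natPair.comp
      (Primrec.nat_add.comp (Primrec.fst.comp Primrec.unpair) (Primrec.const N))
      (Primrec.snd.comp Primrec.unpair)).to_comp
  refine join_compRed hU (hf.comp shift_computable) hg (fun x y => ?_) hgU
    fun x y => hN _ (by simp) y
  rw [← hfU, columns_pair, Nat.add_right_cancel_iff]
  rfl

theorem join_idEq_setEquiv_compRed (A B : Set ℕ) :
    CompRed (Join IdEq (SetEquiv B)) (Join (Columns A) (SetEquiv B)) := by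
  obtain ⟨f, hf, hfA⟩ := idEq_compRed_columns A
  exact join_compRed ((equivalence_columns A).join (equivalence_setEquiv B))
    (computable_two_mul.comp hf) computable_two_mul_add_one
    (fun x y => (hfA x y).trans Join.even_even.symm) (fun _ _ => Join.odd_odd.symm)
    fun _ _ => Join.not_even_odd

theorem not_setEquiv_compRed {R : ℕ → ℕ → Prop} {B : Set ℕ}
    (hB : ∀ g : ℕ → ℕ, Computable g → ∀ k, B ≠ {x | R (g x) k}) (hne : B.Nonempty) :
    ¬ CompRed (SetEquiv B) R := by
  rintro ⟨g, hg, hgR⟩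
  obtain ⟨b, hb⟩ := hne
  refine hB g hg (g b) (Set.ext fun x => ?_)
  rw [Set.mem_ofPred_eq, ← hgR]
  exact (iff_true_right hb).symm

/-- If `A` is nonempty and noncomputable, then `Columns A` does not reduce to the join of the
identity with a relation having at most two classes. -/
theorem not_columns_compRed {A : Set ℕ} (hA : ∀ g : ℕ → ℕ, Computable g → ∀ k, A ≠ {x | g x = k})
    (hne : A.Nonempty) (B : Set ℕ) : ¬ CompRed (Columns A) (Join IdEq (SetEquiv B)) := by
  rintro ⟨f, hf, hfS⟩
  have hS := equivalence_idEq.join (equivalence_setEquiv B)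
  obtain ⟨a, ha⟩ := hne
  obtain ⟨N, hN⟩ := Columns.exists_avoid_setEquiv hS hfS (g := fun x => 2 * x + 1)
    fun _ _ => Join.odd_odd.symm
  refine hA (fun x => f (Nat.pair N x)) (hf.comp (computable_pair_left N)) (f (Nat.pair N a))
    (Set.ext fun x => ?_)
  have even_image (x : ℕ) : ∃ k, f (Nat.pair N x) = 2 * k := by
    obtain ⟨k, hk | hk⟩ := (f (Nat.pair N x)).even_or_odd'
    · exact ⟨k, hk⟩
    · exact (hN (Nat.pair N x) (by simp) k (hk ▸ hS.refl _)).elim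
  have key := hfS (Nat.pair N x) (Nat.pair N a)
  obtain ⟨k, hk⟩ := even_image x
  obtain ⟨l, hl⟩ := even_image a
  rw [columns_pair, hk, hl, Join.even_even] at key
  simp only [SetEquiv, IdEq, ha, iff_true, true_and] at key
  rw [Set.mem_ofPred_eq, hk, hl, key]
  omega

theorem stmt_10 : ∃ R S : ℕ → ℕ → Prop, Equivalence R ∧ Equivalence S ∧
    (classes R).Infinite ∧ (classes S).Infinite ∧
    ¬ CompRed R S ∧ ¬ CompRed S R ∧
    ∃ T : ℕ → ℕ → Prop, Equivalence T ∧ IsLub' R S T := by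
  obtain ⟨A, hA⟩ := exists_ne_preimage_class IdEq
  have hA_ne : A.Nonempty := Set.nonempty_iff_ne_empty.2 fun h =>
    hA (fun _ => 0) (Computable.const 0) 1 (by simp [h, IdEq])
  obtain ⟨B, hB⟩ := exists_ne_preimage_class (Columns A)
  have hB_ne : B.Nonempty := Set.nonempty_iff_ne_empty.2 fun h =>
    hB (fun _ => Nat.pair 0 0) (Computable.const _) (Nat.pair 1 0) (by simp [h, columns_pair])
  have hR := equivalence_columns A
  have hS := equivalence_idEq.join (equivalence_setEquiv B)
  exact ⟨Columns A, Join IdEq (SetEquiv B), hR, hS,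
    infinite_classes_of_compRed_idEq hR (idEq_compRed_columns A),
    infinite_classes_of_compRed_idEq hS (compRed_join_left _ _),
    not_columns_compRed hA hA_ne B,
    fun h => not_setEquiv_compRed hB hB_ne ((compRed_join_right _ _).trans h),
    Join (Columns A) (SetEquiv B), hR.join (equivalence_setEquiv B),
    compRed_join_left _ _, join_idEq_setEquiv_compRed A B,
    fun U hU hRU hSU =>
      join_columns_setEquiv_compRed hU hRU ((compRed_join_right _ _).trans hSU)⟩
end

section
/- Let R be an equivalence relation on ℕ and let c : ℕ → ℕ → Bool be a computable function such that for every i, the set C_i := {x : c i x = true} is an R-equivalence class, and C_i ≠ C_j whenever i ≠ j. Let S ⊆ ℕ be a finite set. Then there is a computable reduction f of R to itself such that for every i ∈ S, the range of f is disjoint from C_i. -/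
/-- Minimization of a computable predicate that always has a witness is computable. -/
theorem exists_computable_least (p : ℕ → ℕ → Bool) (hp : Computable₂ p)
    (h : ∀ x, ∃ k, p x k = true) :
    ∃ g : ℕ → ℕ, Computable g ∧ (∀ x, p x (g x) = true) ∧
      ∀ x k, p x k = true → g x ≤ k := by
  refine ⟨fun x => Nat.find (h x), ?_, fun x => Nat.find_spec (h x),
    fun x k hk => Nat.find_min' (h x) hk⟩
  have hpart : Partrec fun x => Nat.rfind fun k => (Part.some (p x k) : Part Bool) :=
    Partrec.rfind (p := fun x k => Part.some (p x k)) hp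
  refine hpart.of_eq fun x => Part.eq_some_iff.2 (Nat.mem_rfind.2 ⟨?_, fun {m} hm => ?_⟩)
  · exact Part.mem_some_iff.2 (Nat.find_spec (h x)).symm
  · have := Nat.find_min (h x) hm
    exact Part.mem_some_iff.2 (by simpa using this)

theorem computable₂_decide_lt {α β : Type*} [Primcodable α] [Primcodable β] {f g : α → β → ℕ}
    (hf : Computable₂ f) (hg : Computable₂ g) :
    Computable₂ fun a b => decide (f a b < g a b) :=
  (Primrec.nat_lt.decide.to_comp).comp₂ hf hg

/-- A computable sequence of pairwise disjoint nonempty decidable sets, uniformly given, has a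
computable strictly increasing subsequence, starting with any prescribed number of its members,
such that membership in one of the sets of the subsequence bounds the index. -/
theorem exists_sparse_subsequence (c : ℕ → ℕ → Bool) (hc : Computable₂ c)
    (hne : ∀ i, ∃ x, c i x = true)
    (hdisj : ∀ i j x, c i x = true → c j x = true → i = j) (n : ℕ) :
    ∃ e : ℕ → ℕ, Computable e ∧ StrictMono e ∧ (∀ k ≤ n, e k = k) ∧
      ∀ k x, c (e k) x = true → k ≤ x + n := by
  obtain ⟨r, hr, hrc, hrmin⟩ := exists_computable_least c hc hne
  have hrinj : Function.Injective r := fun i j hij => hdisj i j (r i) (hrc i) (hij ▸ hrc j)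
  have hnext : ∀ s, ∃ i, (decide (s < i) && (decide (s < n) || decide (s < r i))) = true := by
    intro s
    obtain ⟨i, hi, hi'⟩ := ((hrinj.nat_tendsto_atTop.eventually_gt_atTop s).and
      (Filter.eventually_gt_atTop s)).exists
    exact ⟨i, by simp [hi, hi']⟩
  obtain ⟨t, ht, hts, htmin⟩ := exists_computable_least
    (fun s i => decide (s < i) && (decide (s < n) || decide (s < r i)))
    (Primrec.and.to_comp.comp₂ (computable₂_decide_lt Computable.fst Computable.snd)
      (Primrec.or.to_comp.comp₂
        (computable₂_decide_lt Computable.fst (Computable.const n))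
        (computable₂_decide_lt Computable.fst (hr.comp Computable.snd)))) hnext
  simp only [Bool.and_eq_true, Bool.or_eq_true, decide_eq_true_eq] at hts htmin
  let e : ℕ → ℕ := fun k => Nat.rec 0 (fun _ s => t s) k
  have he : ∀ k, e (k + 1) = t (e k) := fun _ => rfl
  have hmono : StrictMono e := strictMono_nat_of_lt_succ fun k => (hts (e k)).1
  refine ⟨e, ?_, hmono, ?_, ?_⟩
  · exact Computable.nat_rec (f := fun k : ℕ => k) (g := fun _ => 0) (h := fun _ q => t q.2)
      Computable.id (Computable.const 0) (ht.comp (Computable.snd.comp Computable.snd))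
  · intro k
    induction k with
    | zero => exact fun _ => rfl
    | succ k ih =>
      intro hk
      have h1 := htmin k (k + 1) ⟨k.lt_succ_self, Or.inl hk⟩
      have h2 := (hts k).1
      rw [he, ih (by omega)]
      omega
  · rintro (_ | k) x hx
    · omega
    · have h1 := hrmin _ _ hx
      have h2 := (hts (e k)).2
      have h3 := hmono.le_apply (x := k)
      rw [he] at h1
      omega

theorem stmt_12 (R : ℕ → ℕ → Prop) (hR : Equivalence R)
    (c : ℕ → ℕ → Bool) (hc : Computable₂ c)
    (hclass : ∀ i, {x | c i x = true} ∈ classes R)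
    (hinj : ∀ i j, i ≠ j → {x | c i x = true} ≠ {x | c j x = true})
    (S : Finset ℕ) :
    ∃ f : ℕ → ℕ, Computable f ∧ (∀ x y, R x y ↔ R (f x) (f y)) ∧
      ∀ i ∈ S, ∀ x, c i (f x) ≠ true := by
  choose a ha using hclass
  have hca : ∀ i x, c i x = true ↔ R x (a i) := fun i x => Set.ext_iff.1 (ha i) x
  have hR_of_mem : ∀ {i x y}, c i x = true → c i y = true → R x y := fun {i x y} hx hy =>
    hR.trans ((hca i x).1 hx) (hR.symm ((hca i y).1 hy))
  have hmem_of_R : ∀ {i x y}, R x y → c i x = true → c i y = true := fun {i x y} hxy hx =>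
    (hca i y).2 (hR.trans (hR.symm hxy) ((hca i x).1 hx))
  have hne : ∀ i, ∃ x, c i x = true := fun i => ⟨a i, (hca i _).2 (hR.refl _)⟩
  have hdisj : ∀ i j x, c i x = true → c j x = true → i = j := by
    intro i j x hi hj
    by_contra hij
    refine hinj i j hij (Set.ext fun y => ⟨fun hy => ?_, fun hy => ?_⟩)
    · exact hmem_of_R (hR_of_mem hi hy) hj
    · exact hmem_of_R (hR_of_mem hj hy) hi
  obtain ⟨n, hn⟩ : ∃ n, ∀ i ∈ S, i < n :=
    ⟨S.sup id + 1, fun i hi => Nat.lt_succ_of_le (Finset.le_sup (f := id) hi)⟩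
  obtain ⟨r, hr, hrc, -⟩ := exists_computable_least c hc hne
  obtain ⟨e, he, hmono, hen, hbound⟩ := exists_sparse_subsequence c hc hne hdisj n
  have hadd : Computable₂ fun x y : ℕ => x + y := Primrec.nat_add.to_comp
  obtain ⟨g, hg, hgs, hgmin⟩ := exists_computable_least
    (fun x k => c (e k) x || decide (x + n < k))
    (Primrec.or.to_comp.comp₂ (hc.comp₂ (he.comp Computable.snd) Computable.fst)
      (computable₂_decide_lt (hadd.comp Computable.fst (Computable.const n)) Computable.snd))
    (fun x => ⟨x + n + 1, by simp⟩)
  simp only [Bool.or_eq_true, decide_eq_true_eq] at hgs hgmin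
  have hg_eq : ∀ {k x}, c (e k) x = true → g x = k := by
    intro k x hx
    have h1 := hbound k x hx
    have h2 := hgmin x k (Or.inl hx)
    have h3 : c (e (g x)) x = true := (hgs x).resolve_right (by omega)
    exact hmono.injective (hdisj _ _ x h3 hx)
  let f : ℕ → ℕ := fun x => bif c (e (g x)) x then r (e (g x + n)) else x
  have hf_pos : ∀ {k x}, c (e k) x = true → f x = r (e (k + n)) := by
    intro k x hx
    have hgx := hg_eq hx
    simp only [f, hgx, hx, cond_true]
  have hf_neg : ∀ {x}, (¬ ∃ k, c (e k) x = true) → f x = x := by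
    intro x hx
    have : c (e (g x)) x = false := by simpa using fun h => hx ⟨_, h⟩
    simp only [f, this, cond_false]
  refine ⟨f, ?_, fun x y => ?_, fun i hi x hix => ?_⟩
  · exact Computable.cond (hc.comp (he.comp hg) Computable.id)
      (hr.comp (he.comp (hadd.comp hg (Computable.const n)))) Computable.id
  · by_cases hx : ∃ k, c (e k) x = true <;> by_cases hy : ∃ k, c (e k) y = true
    · obtain ⟨k, hk⟩ := hx
      obtain ⟨l, hl⟩ := hy
      rw [hf_pos hk, hf_pos hl]
      constructor
      · intro h
        rw [hmono.injective (hdisj _ _ y (hmem_of_R h hk) hl)]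
        exact hR.refl _
      · intro h
        have h1 := hmono.injective (hdisj _ _ _ (hmem_of_R h (hrc _)) (hrc _))
        obtain rfl : k = l := by omega
        exact hR_of_mem hk hl
    · obtain ⟨k, hk⟩ := hx
      rw [hf_pos hk, hf_neg hy]
      exact ⟨fun h => (hy ⟨_, hmem_of_R h hk⟩).elim,
        fun h => (hy ⟨_, hmem_of_R h (hrc _)⟩).elim⟩
    · obtain ⟨l, hl⟩ := hy
      rw [hf_pos hl, hf_neg hx]
      exact ⟨fun h => (hx ⟨_, hmem_of_R (hR.symm h) hl⟩).elim,
        fun h => (hx ⟨_, hmem_of_R (hR.symm h) (hrc _)⟩).elim⟩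
    · rw [hf_neg hx, hf_neg hy]
  · have hin := hn i hi
    have hei := hen i hin.le
    by_cases hx : ∃ k, c (e k) x = true
    · obtain ⟨k, hk⟩ := hx
      rw [hf_pos hk] at hix
      have h1 := hdisj _ _ _ hix (hrc _)
      have h2 := hmono.le_apply (x := k + n)
      omega
    · rw [hf_neg hx] at hix
      exact hx ⟨i, by rwa [hei]⟩
end

section
/- Let R be an equivalence relation on ℕ, let f be a computable reduction of R to itself, and let a ∈ ℕ be such that the class {z : R z a} is a decidable set but the class {z : R z (f a)} is not decidable. Then there is a computable reduction g of R to itself whose range is disjoint from {z : R z a}; consequently, the range of f ∘ g is disjoint from {z : R z (f a)}. -/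
/-- A uniformly decidable sequence of nonempty pairwise disjoint sets has a subsequence, starting
with the same set, that is uniformly decidable and whose `k`-th member has no element below `k`. -/
theorem exists_computable_subsequence {P : ℕ → ℕ → Prop}
    (hP : ComputablePred fun p : ℕ × ℕ => P p.1 p.2) (hne : ∀ k, ∃ x, P k x)
    (hdisj : ∀ k l x, P k x → P l x → k = l) :
    ∃ s : ℕ → ℕ, Computable s ∧ StrictMono s ∧ s 0 = 0 ∧ ∀ j x, P (s j) x → j ≤ x := by
  classical
  let y : ℕ → ℕ := fun k => Nat.find (hne k)
  have hy : Computable y := Computable.find hP hne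
  have hyspec : ∀ k, P k (y k) := fun k => Nat.find_spec (hne k)
  have hyinj : Function.Injective y := fun k l h =>
    hdisj k l (y k) (hyspec k) (h ▸ hyspec l)
  have hex : ∀ q : ℕ × ℕ, ∃ k, q.2 < k ∧ q.1 < y k := fun q =>
    ((Filter.eventually_gt_atTop q.2).and
      (hyinj.nat_tendsto_atTop.eventually_gt_atTop q.1)).exists
  let next : ℕ × ℕ → ℕ := fun q => Nat.find (hex q)
  have hnext : Computable next := by
    refine Computable.find (P := fun (q : ℕ × ℕ) k => q.2 < k ∧ q.1 < y k) ?_ hex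
    refine Computable.computablePred ?_
    have hlt : Computable₂ fun m n : ℕ => decide (m < n) := Primrec.nat_lt.decide.to_comp
    have h₁ : Computable fun p : (ℕ × ℕ) × ℕ => decide (p.1.2 < p.2) :=
      hlt.comp (Computable.snd.comp Computable.fst) Computable.snd
    have h₂ : Computable fun p : (ℕ × ℕ) × ℕ => decide (p.1.1 < y p.2) :=
      hlt.comp (Computable.fst.comp Computable.fst) (hy.comp Computable.snd)
    exact (Primrec.and.to_comp.comp h₁ h₂).of_eq fun p => by simp
  let s : ℕ → ℕ := fun j => Nat.rec 0 (fun i k => next (i, k)) j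
  have hs : Computable s :=
    Computable.nat_rec (h := fun _ q => next q) Computable.id (Computable.const 0)
      (hnext.comp Computable.snd).to₂
  have hnext_spec : ∀ q, q.2 < next q ∧ q.1 < y (next q) := fun q => Nat.find_spec (hex q)
  have hstep : ∀ j, s j < s (j + 1) ∧ j < y (s (j + 1)) := fun j => hnext_spec (j, s j)
  refine ⟨s, hs, strictMono_nat_of_lt_succ fun j => (hstep j).1, rfl, fun j x hx => ?_⟩
  have hyx : y (s j) ≤ x := Nat.find_min' (hne (s j)) hx
  cases j with
  | zero => exact Nat.zero_le x
  | succ i => exact (hstep i).2.trans_le hyx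

/-- If infinitely many pairwise distinct classes of `R` are uniformly decidable, then some
computable self-reduction of `R` avoids the first of them. -/
theorem exists_selfReduction_avoiding {R P : ℕ → ℕ → Prop} (hR : Equivalence R)
    (hP : ComputablePred fun p : ℕ × ℕ => P p.1 p.2) (hne : ∀ k, ∃ x, P k x)
    (hclass : ∀ k x z, P k x → (P k z ↔ R z x))
    (hdisj : ∀ k l x, P k x → P l x → k = l) :
    ∃ g : ℕ → ℕ, Computable g ∧ (∀ x y, R x y ↔ R (g x) (g y)) ∧ ∀ x, ¬ P 0 (g x) := by
  classical
  obtain ⟨s, hs, hmono, hs0, hle⟩ := exists_computable_subsequence hP hne hdisj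
  let Q : ℕ → ℕ → Prop := fun j x => P (s j) x
  have hQ : Computable₂ fun j x => decide (Q j x) :=
    hP.decide.comp (Computable.pair (hs.comp Computable.fst) Computable.snd)
  have hQdisj : ∀ i j x, Q i x → Q j x → i = j := fun i j x hi hj =>
    hmono.injective (hdisj _ _ x hi hj)
  have hQne : ∀ j, ∃ x, Q j x := fun j => hne (s j)
  let rep : ℕ → ℕ := fun j => Nat.find (hQne j)
  have hrep : Computable rep := Computable.find (P := Q) (Computable.computablePred hQ) hQne
  have hex : ∀ x, ∃ j, Q j x ∨ x < j := fun x => ⟨x + 1, Or.inr x.lt_succ_self⟩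
  let idx : ℕ → ℕ := fun x => Nat.find (hex x)
  have hidx : Computable idx := by
    refine Computable.find (P := fun x j => Q j x ∨ x < j) (Computable.computablePred ?_) hex
    have h₁ : Computable fun p : ℕ × ℕ => decide (Q p.2 p.1) :=
      hQ.comp Computable.snd Computable.fst
    have h₂ : Computable fun p : ℕ × ℕ => decide (p.1 < p.2) := Primrec.nat_lt.decide.to_comp
    exact (Primrec.or.to_comp.comp h₁ h₂).of_eq fun p => by simp
  let g : ℕ → ℕ := fun x => if Q (idx x) x then rep (idx x + 1) else x
  have hg : Computable g :=
    ComputablePred.ite (hrep.comp (Computable.succ.comp hidx)) Computable.id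
      (Computable.computablePred (hQ.comp hidx Computable.id))
  have hgQ : ∀ j x, Q j x → Q (j + 1) (g x) := by
    intro j x hj
    have hmin : idx x ≤ j := Nat.find_min' (hex x) (Or.inl hj)
    have hidxQ : Q (idx x) x :=
      (Nat.find_spec (hex x)).resolve_right (hmin.trans (hle j x hj)).not_gt
    have hgx : g x = rep (j + 1) := by
      rw [← hQdisj _ _ x hidxQ hj]
      exact if_pos hidxQ
    rw [hgx]
    exact Nat.find_spec (hQne (j + 1))
  have hgid : ∀ x, (∀ j, ¬ Q j x) → g x = x := fun x hx => if_neg (hx _)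
  have hQR : ∀ {j x z}, Q j x → (Q j z ↔ R z x) := fun h => hclass _ _ _ h
  refine ⟨g, hg, fun x y => ?_, fun x hx => ?_⟩
  · by_cases hx : ∃ i, Q i x
    · obtain ⟨i, hi⟩ := hx
      rw [show R x y ↔ R y x from ⟨hR.symm, hR.symm⟩,
        show R (g x) (g y) ↔ R (g y) (g x) from ⟨hR.symm, hR.symm⟩,
        ← hQR hi, ← hQR (hgQ i x hi)]
      refine ⟨hgQ i y, fun h => ?_⟩
      by_cases hy : ∃ j, Q j y
      · obtain ⟨j, hj⟩ := hy
        have := hQdisj _ _ _ h (hgQ j y hj)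
        obtain rfl : i = j := by omega
        exact hj
      · rw [hgid y (not_exists.1 hy)] at h
        exact (hy ⟨_, h⟩).elim
    · rw [hgid x (not_exists.1 hx)]
      by_cases hy : ∃ j, Q j y
      · obtain ⟨j, hj⟩ := hy
        rw [← hQR hj, ← hQR (hgQ j y hj)]
        exact iff_of_false (fun h => hx ⟨_, h⟩) (fun h => hx ⟨_, h⟩)
      · rw [hgid y (not_exists.1 hy)]
  · have hx0 : Q 0 (g x) := by
      change P (s 0) (g x)
      rwa [hs0]
    by_cases h : ∃ j, Q j x
    · obtain ⟨j, hj⟩ := h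
      exact Nat.succ_ne_zero j (hQdisj _ _ _ (hgQ j x hj) hx0)
    · rw [hgid x (not_exists.1 h)] at hx0
      exact h ⟨0, hx0⟩

theorem computable₂_iterate {f : ℕ → ℕ} (hf : Computable f) :
    Computable₂ fun k x : ℕ => f^[k] x :=
  (Computable.nat_rec (f := fun p : ℕ × ℕ => p.1) (g := fun p => p.2) (h := fun _ q => f q.2)
    Computable.fst Computable.snd
    (hf.comp (Computable.snd.comp Computable.snd)).to₂).of_eq fun p => by
      induction p.1 with
      | zero => rfl
      | succ k ih => exact (congrArg f ih).trans (Function.iterate_succ_apply' f k p.2).symm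

theorem rel_iterate_iff {R : ℕ → ℕ → Prop} {f : ℕ → ℕ} (hf : ∀ x y, R x y ↔ R (f x) (f y))
    (k x y : ℕ) : R x y ↔ R (f^[k] x) (f^[k] y) := by
  induction k with
  | zero => rfl
  | succ k ih => rw [Function.iterate_succ_apply', Function.iterate_succ_apply', ← hf, ih]

theorem stmt_13 (R : ℕ → ℕ → Prop) (hR : Equivalence R)
    (f : ℕ → ℕ) (hf : Computable f) (hfred : ∀ x y, R x y ↔ R (f x) (f y))
    (a : ℕ) (hdec : ComputablePred fun z => R z a)
    (hndec : ¬ ComputablePred fun z => R z (f a)) :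
    ∃ g : ℕ → ℕ, Computable g ∧ (∀ x y, R x y ↔ R (g x) (g y)) ∧
      (∀ x, ¬ R (g x) a) ∧ (∀ x, ¬ R (f (g x)) (f a)) := by
  suffices h : ∃ g : ℕ → ℕ, Computable g ∧ (∀ x y, R x y ↔ R (g x) (g y)) ∧
      ∀ x, ¬ R (g x) a by
    obtain ⟨g, hg, hgred, hga⟩ := h
    exact ⟨g, hg, hgred, hga, fun x hx => hga x ((hfred _ _).2 hx)⟩
  have hiter := computable₂_iterate hf
  by_cases hne : ∀ k, ∃ x, R (f^[k] x) a
  · have hcycle : ∀ m, ¬ R (f^[m + 1] a) a := by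
      classical
      intro m hm
      refine hndec (ComputablePred.of_eq (p := fun z => R (f^[m] z) a) ?_ fun z => ?_)
      · exact Computable.computablePred
          (hdec.decide.comp (hiter.comp (Computable.const m) Computable.id))
      · rw [rel_iterate_iff hfred m z (f a), ← Function.iterate_succ_apply]
        exact ⟨fun h => hR.trans h (hR.symm hm), fun h => hR.trans h hm⟩
    have hlt : ∀ k l x, k < l → R (f^[k] x) a → ¬ R (f^[l] x) a := by
      intro k l x hkl hk hl
      obtain ⟨m, rfl⟩ := Nat.exists_eq_add_of_lt hkl
      rw [show k + m + 1 = (m + 1) + k by omega, Function.iterate_add_apply] at hl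
      exact hcycle m (hR.trans (hR.symm ((rel_iterate_iff hfred (m + 1) _ _).1 hk)) hl)
    refine exists_selfReduction_avoiding (P := fun k x => R (f^[k] x) a) hR ?_ hne ?_ ?_
    · classical
      exact Computable.computablePred (hdec.decide.comp hiter)
    · intro k x z hx
      rw [rel_iterate_iff hfred k z x]
      exact ⟨fun h => hR.trans h (hR.symm hx), fun h => hR.trans h hx⟩
    · intro k l x hk hl
      rcases lt_trichotomy k l with h | h | h
      · exact (hlt k l x h hk hl).elim
      · exact h
      · exact (hlt l k x h hl hk).elim
  · push Not at hne
    obtain ⟨k, hk⟩ := hne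
    exact ⟨f^[k], hiter.comp (Computable.const k) Computable.id, rel_iterate_iff hfred k, hk⟩
end
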